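/- arXiv:0909.3738 — 3 statements merged into one kernel-verified Lean document; each statement's English description precedes it below -/
import Mathlib

section
/- If h is a log-concave probability density on ℝ with median w and mean μ, then h(w)·|w − μ| ≤ ln√(e/2). -/
open MeasureTheory

def LogConcaveFn (h : ℝ → ℝ) : Prop :=
  (∀ x, 0 ≤ h x) ∧
  ∀ x y l : ℝ, 0 < l → l < 1 → h x ^ (1 - l) * h y ^ l ≤ h ((1 - l) * x + l * y)

noncomputable def expDensity (c x : ℝ) : ℝ := c * Real.exp (-(2 * c) * x)

theorem expDensity_pos {c : ℝ} (hc : 0 < c) (x : ℝ) : 0 < expDensity c x :=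
  mul_pos hc (Real.exp_pos _)

theorem expDensity_zero (c : ℝ) : expDensity c 0 = c := by simp [expDensity]

theorem continuous_expDensity (c : ℝ) : Continuous (expDensity c) := by
  unfold expDensity; fun_prop

theorem expDensity_convexComb {c : ℝ} (hc : 0 < c) (x y l : ℝ) :
    expDensity c x ^ (1 - l) * expDensity c y ^ l = expDensity c ((1 - l) * x + l * y) := by
  unfold expDensity
  rw [Real.mul_rpow hc.le (Real.exp_pos _).le, Real.mul_rpow hc.le (Real.exp_pos _).le,
    ← Real.exp_mul, ← Real.exp_mul, mul_mul_mul_comm, ← Real.rpow_add hc, ← Real.exp_add]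
  simp only [sub_add_cancel, Real.rpow_one]
  ring_nf

theorem exists_convexComb {x y z : ℝ} (hxz : x < z) (hzy : z < y) :
    ∃ l : ℝ, 0 < l ∧ l < 1 ∧ (1 - l) * x + l * y = z := by
  have hxy : 0 < y - x := by linarith
  refine ⟨(z - x) / (y - x), div_pos (by linarith) hxy, (div_lt_one hxy).2 (by linarith), ?_⟩
  field_simp
  ring

theorem LogConcaveFn.expDensity_le {h : ℝ → ℝ} (hlc : LogConcaveFn h) {c : ℝ} (hc : 0 < c)
    {x y z : ℝ} (hxz : x < z) (hzy : z < y) (hx : expDensity c x ≤ h x)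
    (hy : expDensity c y ≤ h y) : expDensity c z ≤ h z := by
  obtain ⟨l, hl0, hl1, rfl⟩ := exists_convexComb hxz hzy
  rw [← expDensity_convexComb hc]
  refine le_trans ?_ (hlc.2 x y l hl0 hl1)
  exact mul_le_mul (Real.rpow_le_rpow (expDensity_pos hc x).le hx (by linarith))
    (Real.rpow_le_rpow (expDensity_pos hc y).le hy hl0.le)
    (Real.rpow_nonneg (expDensity_pos hc y).le _) (Real.rpow_nonneg (hlc.1 x) _)

theorem LogConcaveFn.expDensity_lt {h : ℝ → ℝ} (hlc : LogConcaveFn h) {c : ℝ} (hc : 0 < c)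
    {x y z : ℝ} (hxz : x < z) (hzy : z < y) (hx : expDensity c x < h x)
    (hy : expDensity c y ≤ h y) : expDensity c z < h z := by
  obtain ⟨l, hl0, hl1, rfl⟩ := exists_convexComb hxz hzy
  rw [← expDensity_convexComb hc]
  refine lt_of_lt_of_le ?_ (hlc.2 x y l hl0 hl1)
  exact mul_lt_mul (Real.rpow_lt_rpow (expDensity_pos hc x).le hx (by linarith))
    (Real.rpow_le_rpow (expDensity_pos hc y).le hy hl0.le)
    (Real.rpow_pos_of_pos (expDensity_pos hc y) _) (Real.rpow_nonneg (hlc.1 x) _)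

theorem hasDerivAt_expDensity_primitive (c x : ℝ) :
    HasDerivAt (fun x => -(1 / 2) * Real.exp (-(2 * c) * x)) (expDensity c x) x := by
  have h := (((hasDerivAt_id x).const_mul (-(2 * c))).exp).const_mul (-(1 / 2) : ℝ)
  refine h.congr_deriv ?_
  simp only [expDensity, id]
  ring

theorem hasDerivAt_mul_expDensity_primitive {c : ℝ} (hc : 0 < c) (x : ℝ) :
    HasDerivAt (fun x => -(x / 2 + 1 / (4 * c)) * Real.exp (-(2 * c) * x))
      (x * expDensity c x) x := by
  have h := ((((hasDerivAt_id x).div_const 2).add_const (1 / (4 * c))).neg).mul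
    (((hasDerivAt_id x).const_mul (-(2 * c))).exp)
  refine h.congr_deriv ?_
  simp only [expDensity, id, Pi.neg_apply]
  field_simp
  ring

theorem tendsto_exp_neg_two_mul {c : ℝ} (hc : 0 < c) :
    Filter.Tendsto (fun x => Real.exp (-(2 * c) * x)) Filter.atTop (nhds 0) :=
  Real.tendsto_exp_atBot.comp
    (Filter.tendsto_id.const_mul_atTop_of_neg (by linarith : -(2 * c) < 0))

theorem tendsto_expDensity_primitive {c : ℝ} (hc : 0 < c) :
    Filter.Tendsto (fun x => -(1 / 2) * Real.exp (-(2 * c) * x)) Filter.atTop (nhds 0) := by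
  simpa using (tendsto_exp_neg_two_mul hc).const_mul (-(1 / 2) : ℝ)

theorem tendsto_mul_expDensity_primitive {c : ℝ} (hc : 0 < c) :
    Filter.Tendsto (fun x => -(x / 2 + 1 / (4 * c)) * Real.exp (-(2 * c) * x))
      Filter.atTop (nhds 0) := by
  have h1 : Filter.Tendsto (fun x : ℝ => 2 * c * x) Filter.atTop Filter.atTop :=
    Filter.tendsto_id.const_mul_atTop (by linarith : 0 < 2 * c)
  have h2 := ((Real.tendsto_pow_mul_exp_neg_atTop_nhds_zero 1).comp h1).const_mul (-(1 / (4 * c)))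
  have h3 := (tendsto_exp_neg_two_mul hc).const_mul (-(1 / (4 * c)))
  have h4 := h2.add h3
  simp only [mul_zero, add_zero] at h4
  refine h4.congr fun x => ?_
  simp only [Function.comp, pow_one, neg_mul]
  field_simp
  ring

theorem integrableOn_expDensity {c : ℝ} (hc : 0 < c) :
    IntegrableOn (expDensity c) (Set.Ioi 0) :=
  integrableOn_Ioi_deriv_of_nonneg' (fun x _ => hasDerivAt_expDensity_primitive c x)
    (fun x _ => (expDensity_pos hc x).le) (tendsto_expDensity_primitive hc)

theorem integral_Ioi_expDensity {c : ℝ} (hc : 0 < c) :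
    ∫ x in Set.Ioi 0, expDensity c x = 1 / 2 := by
  rw [integral_Ioi_of_hasDerivAt_of_nonneg' (fun x _ => hasDerivAt_expDensity_primitive c x)
    (fun x _ => (expDensity_pos hc x).le) (tendsto_expDensity_primitive hc)]
  norm_num

theorem integrableOn_mul_expDensity {c : ℝ} (hc : 0 < c) :
    IntegrableOn (fun x => x * expDensity c x) (Set.Ioi 0) :=
  integrableOn_Ioi_deriv_of_nonneg' (fun x _ => hasDerivAt_mul_expDensity_primitive hc x)
    (fun x hx => mul_nonneg (le_of_lt hx) (expDensity_pos hc x).le)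
    (tendsto_mul_expDensity_primitive hc)

theorem integral_Ioi_mul_expDensity {c : ℝ} (hc : 0 < c) :
    ∫ x in Set.Ioi 0, x * expDensity c x = 1 / (4 * c) := by
  rw [integral_Ioi_of_hasDerivAt_of_nonneg' (fun x _ => hasDerivAt_mul_expDensity_primitive hc x)
    (fun x hx => mul_nonneg (le_of_lt hx) (expDensity_pos hc x).le)
    (tendsto_mul_expDensity_primitive hc)]
  norm_num

theorem exp_two_mul_log_two_div {c : ℝ} (hc : 0 < c) :
    Real.exp (-(2 * c) * -(Real.log 2 / (2 * c))) = 2 := by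
  rw [show -(2 * c) * -(Real.log 2 / (2 * c)) = Real.log 2 by field_simp,
    Real.exp_log (by norm_num)]

theorem integral_Ioc_expDensity {c : ℝ} (hc : 0 < c) :
    ∫ x in Set.Ioc (-(Real.log 2 / (2 * c))) 0, expDensity c x = 1 / 2 := by
  have ha : 0 ≤ Real.log 2 / (2 * c) := by positivity
  rw [← intervalIntegral.integral_of_le (by linarith),
    intervalIntegral.integral_eq_sub_of_hasDerivAt
      (fun x _ => hasDerivAt_expDensity_primitive c x)
      ((continuous_expDensity c).intervalIntegrable _ _), exp_two_mul_log_two_div hc]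
  norm_num

theorem integral_Ioc_mul_expDensity {c : ℝ} (hc : 0 < c) :
    ∫ x in Set.Ioc (-(Real.log 2 / (2 * c))) 0, x * expDensity c x =
      1 / (4 * c) - Real.log 2 / (2 * c) := by
  have ha : 0 ≤ Real.log 2 / (2 * c) := by positivity
  rw [← intervalIntegral.integral_of_le (by linarith),
    intervalIntegral.integral_eq_sub_of_hasDerivAt
      (fun x _ => hasDerivAt_mul_expDensity_primitive hc x)
      ((continuous_id.mul (continuous_expDensity c)).intervalIntegrable _ _),
    exp_two_mul_log_two_div hc]
  simp only [mul_zero, Real.exp_zero]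
  field_simp
  ring

/-- If `g - f` has zero integral and changes sign from `-` to `+` at `b`, then `f` has the smaller
first moment. -/
theorem setIntegral_mul_le_of_single_crossing {f g : ℝ → ℝ} {s : Set ℝ} (hs : MeasurableSet s)
    (hf : IntegrableOn f s) (hg : IntegrableOn g s)
    (hxf : IntegrableOn (fun x => x * f x) s) (hxg : IntegrableOn (fun x => x * g x) s)
    (heq : ∫ x in s, f x = ∫ x in s, g x) (b : ℝ)
    (hcross : ∀ x ∈ s, 0 ≤ (x - b) * (g x - f x)) :
    ∫ x in s, x * f x ≤ ∫ x in s, x * g x := by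
  have h0 : 0 ≤ ∫ x in s, (x - b) * (g x - f x) := setIntegral_nonneg hs hcross
  have h1 : ∫ x in s, (x - b) * (g x - f x) =
      ((∫ x in s, x * g x) - ∫ x in s, x * f x) - b * ((∫ x in s, g x) - ∫ x in s, f x) := by
    rw [← integral_sub hg hf, ← integral_sub hxg hxf, ← integral_const_mul,
      ← integral_sub (by exact hxg.sub hxf) (by exact (hg.sub hf).const_mul b)]
    congr 1
    ext x
    ring
  rw [heq] at h1
  linarith

theorem exists_pos_expDensity_le {h : ℝ → ℝ} {c : ℝ} (hc : 0 < c)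
    (hi : Integrable h) (hr : ∫ x in Set.Ioi 0, h x = 1 / 2) :
    ∃ t, 0 < t ∧ expDensity c t ≤ h t := by
  by_contra! hcon
  have hmem := ae_restrict_mem (μ := volume) (measurableSet_Ioi (a := (0 : ℝ)))
  have hae := (integral_eq_iff_of_ae_le hi.integrableOn (integrableOn_expDensity hc)
    (hmem.mono fun x hx => (hcon x hx).le)).1 (hr.trans (integral_Ioi_expDensity hc).symm)
  have : (ae (volume.restrict (Set.Ioi (0 : ℝ)))).NeBot := by
    rw [ae_neBot, Ne, Measure.restrict_eq_zero, Real.volume_Ioi]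
    exact ENNReal.top_ne_zero
  obtain ⟨x, hx, hxe⟩ := (hmem.and hae).exists
  exact (hcon x hx).ne hxe

theorem LogConcaveFn.integral_Ioi_mul_le {h : ℝ → ℝ} (hlc : LogConcaveFn h) (hc : 0 < h 0)
    (hi : Integrable h) (hmi : Integrable (fun x => x * h x))
    (hr : ∫ x in Set.Ioi 0, h x = 1 / 2) :
    ∫ x in Set.Ioi 0, x * h x ≤ 1 / (4 * h 0) := by
  rw [← integral_Ioi_mul_expDensity hc]
  have h0 : expDensity (h 0) 0 ≤ h 0 := (expDensity_zero _).le
  have heq : ∫ x in Set.Ioi 0, h x = ∫ x in Set.Ioi 0, expDensity (h 0) x :=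
    hr.trans (integral_Ioi_expDensity hc).symm
  by_cases hall : ∀ t, 0 < t → expDensity (h 0) t ≤ h t
  · have hae : expDensity (h 0) =ᵐ[volume.restrict (Set.Ioi 0)] h := by
      exact (integral_eq_iff_of_ae_le (integrableOn_expDensity hc) hi.integrableOn
        ((ae_restrict_mem measurableSet_Ioi).mono hall)).1 heq.symm
    exact (integral_congr_ae (hae.mono fun x hx => by simp only [hx])).ge
  · push Not at hall
    obtain ⟨t, ht, htlt⟩ := hall
    have hbdd : BddAbove {x | 0 ≤ x ∧ expDensity (h 0) x ≤ h x} := by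
      refine ⟨t, fun x hx => ?_⟩
      by_contra! hxt
      exact htlt.not_ge (hlc.expDensity_le hc ht hxt h0 hx.2)
    refine setIntegral_mul_le_of_single_crossing measurableSet_Ioi hi.integrableOn
      (integrableOn_expDensity hc) hmi.integrableOn (integrableOn_mul_expDensity hc) heq
      (sSup {x | 0 ≤ x ∧ expDensity (h 0) x ≤ h x}) fun x (hx : 0 < x) => ?_
    by_cases hxle : expDensity (h 0) x ≤ h x
    · exact mul_nonneg_of_nonpos_of_nonpos (sub_nonpos.2 (le_csSup hbdd ⟨hx.le, hxle⟩))
        (sub_nonpos.2 hxle)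
    · refine mul_nonneg (sub_nonneg.2 (csSup_le ⟨0, le_rfl, h0⟩ fun y hy => ?_))
        (sub_nonneg.2 (not_le.1 hxle).le)
      by_contra! hxy
      exact hxle (hlc.expDensity_le hc hx hxy h0 hy.2)

theorem LogConcaveFn.integral_Iic_mul_le {h : ℝ → ℝ} (hlc : LogConcaveFn h) (hc : 0 < h 0)
    (hi : Integrable h) (hmi : Integrable (fun x => x * h x))
    (hl : ∫ x in Set.Iic 0, h x = 1 / 2) (hr : ∫ x in Set.Ioi 0, h x = 1 / 2) :
    ∫ x in Set.Iic 0, x * h x ≤ 1 / (4 * h 0) - Real.log 2 / (2 * h 0) := by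
  obtain ⟨t, ht, hgt⟩ := exists_pos_expDensity_le hc hi hr
  have hle : ∀ x ≤ 0, h x ≤ expDensity (h 0) x := by
    intro x hx
    rcases hx.eq_or_lt with rfl | hx
    · exact (expDensity_zero _).ge
    · by_contra! hlt
      have := hlc.expDensity_lt hc hx ht hlt hgt
      rw [expDensity_zero] at this
      exact lt_irrefl _ this
  set a := Real.log 2 / (2 * h 0) with ha
  have hsub : Set.Iic (0 : ℝ) ∩ Set.Ioc (-a) 0 = Set.Ioc (-a) 0 :=
    Set.inter_eq_right.2 fun x hx => hx.2
  have hmul : (fun x => x * (Set.Ioc (-a) 0).indicator (expDensity (h 0)) x) =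
      (Set.Ioc (-a) 0).indicator fun x => x * expDensity (h 0) x := by
    ext x
    by_cases hx : x ∈ Set.Ioc (-a) 0 <;> simp [hx]
  have hgi : IntegrableOn (expDensity (h 0)) (Set.Ioc (-a) 0) :=
    (continuous_expDensity _).integrableOn_Ioc
  have hxgi : IntegrableOn (fun x => x * expDensity (h 0) x) (Set.Ioc (-a) 0) :=
    (continuous_id.mul (continuous_expDensity _)).integrableOn_Ioc
  have key := setIntegral_mul_le_of_single_crossing (f := h)
    (g := (Set.Ioc (-a) 0).indicator (expDensity (h 0))) (s := Set.Iic 0) measurableSet_Iic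
    hi.integrableOn (hgi.integrable_indicator measurableSet_Ioc).integrableOn hmi.integrableOn
    (by rw [hmul]; exact (hxgi.integrable_indicator measurableSet_Ioc).integrableOn)
    (by rw [setIntegral_indicator measurableSet_Ioc, hsub, hl, integral_Ioc_expDensity hc]) (-a)
    (fun x (hx : x ≤ 0) => by
      by_cases hxa : -a < x
      · rw [Set.indicator_of_mem (show x ∈ Set.Ioc (-a) 0 from ⟨hxa, hx⟩)]
        exact mul_nonneg (by linarith) (sub_nonneg.2 (hle x hx))
      · rw [Set.indicator_of_notMem (fun hm => hxa hm.1)]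
        exact mul_nonneg_of_nonpos_of_nonpos (by linarith) (by linarith [hlc.1 x]))
  rwa [hmul, setIntegral_indicator measurableSet_Ioc, hsub, integral_Ioc_mul_expDensity hc] at key

theorem LogConcaveFn.apply_zero_mul_integral_le {h : ℝ → ℝ} (hlc : LogConcaveFn h)
    (hi : Integrable h) (hmi : Integrable (fun x => x * h x))
    (hl : ∫ x in Set.Iic 0, h x = 1 / 2) (hr : ∫ x in Set.Ioi 0, h x = 1 / 2) :
    h 0 * ∫ x, x * h x ≤ (1 - Real.log 2) / 2 := by
  rcases (hlc.1 0).eq_or_lt with h0 | hc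
  · rw [← h0, zero_mul]
    linarith [Real.log_two_lt_d9]
  · rw [← intervalIntegral.integral_Iic_add_Ioi hmi.integrableOn hmi.integrableOn]
    refine (mul_le_mul_of_nonneg_left (add_le_add (hlc.integral_Iic_mul_le hc hi hmi hl hr)
      (hlc.integral_Ioi_mul_le hc hi hmi hr)) hc.le).trans_eq ?_
    field_simp
    ring

theorem LogConcaveFn.comp_affine {h : ℝ → ℝ} (hlc : LogConcaveFn h) (a b : ℝ) :
    LogConcaveFn fun x => h (a * x + b) := by
  refine ⟨fun x => hlc.1 _, fun x y l hl0 hl1 => (hlc.2 _ _ l hl0 hl1).trans_eq ?_⟩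
  ring_nf

theorem log_sqrt_exp_one_div_two :
    Real.log (Real.sqrt (Real.exp 1 / 2)) = (1 - Real.log 2) / 2 := by
  rw [Real.log_sqrt (by positivity), Real.log_div (Real.exp_pos 1).ne' two_ne_zero, Real.log_exp]

theorem median_mean_estimate
    (h : ℝ → ℝ) (hlc : LogConcaveFn h)
    (hi : Integrable h) (h1 : ∫ x, h x = 1)
    (w μ : ℝ) (hw : ∫ x in Set.Iic w, h x = 1 / 2)
    (hmi : Integrable (fun x => x * h x))
    (hμ : μ = ∫ x, x * h x) :
    h w * |w - μ| ≤ Real.log (Real.sqrt (Real.exp 1 / 2)) := by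
  have hw' : ∫ x in Set.Ioi w, h x = 1 / 2 := by
    have := intervalIntegral.integral_Iic_add_Ioi (b := w) hi.integrableOn hi.integrableOn
    linarith
  have hci : Integrable fun x => (x - w) * h x := by
    simp only [sub_mul]
    exact hmi.sub (hi.const_mul w)
  have hcμ : ∫ x, (x - w) * h x = μ - w := by
    simp only [sub_mul]
    rw [integral_sub hmi (hi.const_mul w), integral_const_mul, h1, hμ, mul_one]
  have hright : h w * (μ - w) ≤ (1 - Real.log 2) / 2 := by
    have hlc' := hlc.comp_affine 1 w
    simp only [one_mul] at hlc'
    have key := hlc'.apply_zero_mul_integral_le (hi.comp_add_right w)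
      (by simpa using hci.comp_add_right w)
      (by simpa [hw] using (measurePreserving_add_right volume w).setIntegral_preimage_emb
            (measurableEmbedding_addRight w) h (Set.Iic w))
      (by simpa [hw'] using (measurePreserving_add_right volume w).setIntegral_preimage_emb
            (measurableEmbedding_addRight w) h (Set.Ioi w))
    have hm := integral_add_right_eq_self (μ := volume) (fun x => (x - w) * h x) w
    simp only [add_sub_cancel_right] at hm
    rwa [hm, hcμ, zero_add] at key
  have hleft : h w * (w - μ) ≤ (1 - Real.log 2) / 2 := by
    have hlc' := hlc.comp_affine (-1) w
    simp only [neg_one_mul, neg_add_eq_sub] at hlc'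
    have hm := integral_sub_left_eq_self (fun x => (x - w) * h x) volume w
    simp only [sub_sub_cancel_left, neg_mul, integral_neg] at hm
    have key := hlc'.apply_zero_mul_integral_le (hi.comp_sub_left w)
      (by simpa using (hci.comp_sub_left w).neg)
      (by simpa [integral_Ici_eq_integral_Ioi, hw'] using
            (Measure.measurePreserving_sub_left volume w).setIntegral_preimage_emb
            (MeasurableEquiv.subLeft w).measurableEmbedding h (Set.Ici w))
      (by simpa [← integral_Iic_eq_integral_Iio, hw] using
            (Measure.measurePreserving_sub_left volume w).setIntegral_preimage_emb
            (MeasurableEquiv.subLeft w).measurableEmbedding h (Set.Iio w))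
    rw [sub_zero] at key
    rwa [neg_eq_iff_eq_neg.1 (hm.trans hcμ), neg_sub] at key
  rw [log_sqrt_exp_one_div_two]
  rcases abs_cases (w - μ) with ⟨ha, -⟩ | ⟨ha, -⟩ <;> rw [ha] <;> linarith
end

section
/- Let f, g be log-concave probability densities on ℝ with zero mean such that ∫_{I_f} f(x)·(1 − √(T'(x)))²/(2√(T'(x))) dx ≤ ε holds for ε ∈ (0, 1/48), where T is the transportation map from f to g. Then ∫_{I_f} f(x)(T(x) − x)² dx ≤ 2²⁰ · f(w_f)^{−2} · ε |ln ε|². -/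
open MeasureTheory

/-- The distribution function `x ↦ ∫_{-∞}^x f`. -/
noncomputable def distFn (f : ℝ → ℝ) (x : ℝ) : ℝ := ∫ t in Set.Iic x, f t

/-- The set where the distribution function of `f` lies strictly between `0` and `1`. For a
log-concave density this is the interior of the support. -/
def distCore (f : ℝ → ℝ) : Set ℝ := {x | 0 < distFn f x ∧ distFn f x < 1}

/-- A log-concave probability density on the real line. -/
structure LogConcaveDensity (f : ℝ → ℝ) : Prop where
  logConcave : LogConcaveFn f
  integrable : Integrable f
  integral_eq_one : ∫ x, f x = 1

theorem LogConcaveFn.mul_le_mul_of_add_eq {f : ℝ → ℝ} (hf : LogConcaveFn f) {a b p q : ℝ}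
    (hap : a ≤ p) (hpb : p ≤ b) (h : p + q = a + b) : f a * f b ≤ f p * f q := by
  rcases hap.eq_or_lt with rfl | hap
  · rw [show q = b by linarith]
  rcases hpb.eq_or_lt with rfl | hpb
  · rw [show q = a by linarith, mul_comm]
  have hd : 0 < b - a := by linarith
  have hl0 : 0 < (p - a) / (b - a) := div_pos (by linarith) hd
  have hl1 : (p - a) / (b - a) < 1 := (div_lt_one hd).2 (by linarith)
  have h1 := hf.2 a b _ hl0 hl1
  have h2 := hf.2 b a _ hl0 hl1
  rw [show (1 - (p - a) / (b - a)) * a + (p - a) / (b - a) * b = p by field_simp; ring] at h1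
  rw [show (1 - (p - a) / (b - a)) * b + (p - a) / (b - a) * a = q by
    rw [show q = a + b - p by linarith]; field_simp; ring] at h2
  generalize (p - a) / (b - a) = l at *
  have hpow : ∀ z : ℝ, 0 ≤ z → z ^ (1 - l) * z ^ l = z := fun z hz => by
    rw [← Real.rpow_add_of_nonneg hz (by linarith) hl0.le]; simp
  calc f a * f b = (f a ^ (1 - l) * f a ^ l) * (f b ^ (1 - l) * f b ^ l) := by
        rw [hpow _ (hf.1 a), hpow _ (hf.1 b)]
    _ = (f a ^ (1 - l) * f b ^ l) * (f b ^ (1 - l) * f a ^ l) := by ring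
    _ ≤ f p * f q := mul_le_mul h1 h2
        (mul_nonneg (Real.rpow_nonneg (hf.1 _) _) (Real.rpow_nonneg (hf.1 _) _)) (hf.1 _)

theorem LogConcaveFn.pos_of_mem_Icc {f : ℝ → ℝ} (hf : LogConcaveFn f) {a b x : ℝ}
    (ha : 0 < f a) (hb : 0 < f b) (hx : x ∈ Set.Icc a b) : 0 < f x := by
  have := hf.mul_le_mul_of_add_eq hx.1 hx.2 (q := a + b - x) (by ring)
  exact pos_of_mul_pos_left ((mul_pos ha hb).trans_le this) (hf.1 _)

namespace LogConcaveDensity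

variable {f : ℝ → ℝ}

theorem comp_neg (hf : LogConcaveDensity f) : LogConcaveDensity fun x => f (-x) where
  logConcave := ⟨fun x => hf.logConcave.1 _, fun x y l h0 h1 => by
    have := hf.logConcave.2 (-x) (-y) l h0 h1
    rwa [show (1 - l) * -x + l * -y = -((1 - l) * x + l * y) by ring] at this⟩
  integrable := hf.integrable.comp_neg
  integral_eq_one := by rw [integral_neg_eq_self f volume]; exact hf.integral_eq_one

theorem nonneg (hf : LogConcaveDensity f) (x : ℝ) : 0 ≤ f x := hf.logConcave.1 x

theorem distFn_nonneg (hf : LogConcaveDensity f) (x : ℝ) : 0 ≤ distFn f x :=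
  setIntegral_nonneg measurableSet_Iic fun t _ => hf.nonneg t

theorem integral_Ioi (hf : LogConcaveDensity f) (x : ℝ) :
    ∫ t in Set.Ioi x, f t = 1 - distFn f x := by
  have := integral_add_compl (measurableSet_Iic (a := x)) hf.integrable
  rw [Set.compl_Iic, hf.integral_eq_one] at this
  simp only [distFn]; linarith

theorem distFn_comp_neg (hf : LogConcaveDensity f) (x : ℝ) :
    distFn (fun t => f (-t)) x = 1 - distFn f (-x) := by
  rw [← hf.integral_Ioi, distFn, integral_comp_neg_Iic]

theorem distCore_comp_neg (hf : LogConcaveDensity f) :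
    distCore (fun t => f (-t)) = Neg.neg ⁻¹' distCore f := by
  ext x
  simp only [distCore, Set.mem_ofPred_eq, Set.mem_preimage, hf.distFn_comp_neg]
  constructor <;> rintro ⟨h1, h2⟩ <;> constructor <;> linarith

theorem distFn_sub (hf : LogConcaveDensity f) (x y : ℝ) :
    distFn f y - distFn f x = ∫ t in x..y, f t :=
  intervalIntegral.integral_Iic_sub_Iic hf.integrable.integrableOn hf.integrable.integrableOn

theorem distFn_mono (hf : LogConcaveDensity f) : Monotone (distFn f) := fun x y hxy => by
  have := hf.distFn_sub x y
  have := intervalIntegral.integral_nonneg (μ := volume) hxy fun t _ => hf.nonneg t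
  linarith

theorem distFn_eq (hf : LogConcaveDensity f) :
    distFn f = fun y => distFn f 0 + ∫ t in (0 : ℝ)..y, f t := by
  ext y; rw [← hf.distFn_sub]; ring

theorem continuous_distFn (hf : LogConcaveDensity f) : Continuous (distFn f) := by
  rw [hf.distFn_eq]
  exact continuous_const.add
    (intervalIntegral.continuous_primitive (fun _ _ => hf.integrable.intervalIntegrable) 0)

theorem tendsto_distFn_atTop (hf : LogConcaveDensity f) :
    Filter.Tendsto (distFn f) Filter.atTop (nhds 1) := by
  rw [← hf.integral_eq_one]
  exact (aecover_Iic Filter.tendsto_id).integral_tendsto_of_countably_generated hf.integrable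

theorem exists_distFn_eq (hf : LogConcaveDensity f) {t : ℝ} (h0 : 0 < t) (h1 : t < 1) :
    ∃ x, distFn f x = t := by
  obtain ⟨b, hb⟩ := (hf.tendsto_distFn_atTop.eventually_const_lt h1).exists
  obtain ⟨a, ha⟩ := (hf.comp_neg.tendsto_distFn_atTop.eventually_const_lt
    (show 1 - t < 1 by linarith)).exists
  rw [hf.distFn_comp_neg] at ha
  exact mem_range_of_exists_le_of_exists_ge hf.continuous_distFn ⟨-a, by linarith⟩ ⟨b, hb.le⟩

theorem distFn_mul_le (hf : LogConcaveDensity f) {x y : ℝ} (hxy : x ≤ y) :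
    distFn f x * f y ≤ f x * distFn f y := by
  have key : ∀ z, distFn f z = ∫ t in Set.Iic (0 : ℝ), f (t + z) := fun z => by
    have := (measurePreserving_add_right volume z).setIntegral_preimage_emb
      (MeasurableEquiv.addRight z).measurableEmbedding f (Set.Iic z)
    rw [distFn, ← this]; simp
  rw [key, key, ← integral_mul_const, ← integral_const_mul]
  refine setIntegral_mono_on ((hf.integrable.comp_add_right x).integrableOn.mul_const _)
    ((hf.integrable.comp_add_right y).integrableOn.const_mul _) measurableSet_Iic fun t ht => ?_
  exact hf.logConcave.mul_le_mul_of_add_eq (by simp at ht; linarith) hxy (by ring)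

theorem one_sub_distFn_mul_le (hf : LogConcaveDensity f) {x y : ℝ} (hxy : x ≤ y) :
    (1 - distFn f y) * f x ≤ f y * (1 - distFn f x) := by
  have := hf.comp_neg.distFn_mul_le (neg_le_neg hxy)
  simpa only [hf.distFn_comp_neg, neg_neg] using this

theorem pos_of_mem_distCore (hf : LogConcaveDensity f) {x : ℝ} (hx : x ∈ distCore f) :
    0 < f x := by
  have left : ∀ {h : ℝ → ℝ}, LogConcaveDensity h → ∀ {z}, 0 < distFn h z → ∃ y ≤ z, 0 < h y := by
    intro h hh z hz
    by_contra! hc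
    exact hz.not_ge (setIntegral_nonpos measurableSet_Iic hc)
  obtain ⟨a, ha, ha'⟩ := left hf hx.1
  obtain ⟨b, hb, hb'⟩ := left hf.comp_neg (z := -x) (by
    rw [hf.distFn_comp_neg, neg_neg]; linarith [hx.2])
  exact hf.logConcave.pos_of_mem_Icc ha' hb' ⟨ha, by linarith⟩

theorem distFn_lt (hf : LogConcaveDensity f) {x y : ℝ} (hx : 0 < f x) (hy : 0 < f y)
    (hxy : x < y) : distFn f x < distFn f y := by
  have := intervalIntegral.intervalIntegral_pos_of_pos_on (hf.integrable.intervalIntegrable)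
    (fun t ht => hf.logConcave.pos_of_mem_Icc hx hy (Set.Ioo_subset_Icc_self ht)) hxy
  linarith [hf.distFn_sub x y]

theorem distFn_le_one (hf : LogConcaveDensity f) (x : ℝ) : distFn f x ≤ 1 := by
  have := hf.comp_neg.distFn_nonneg (-x)
  rw [hf.distFn_comp_neg, neg_neg] at this
  linarith

theorem strictMonoOn_distFn (hf : LogConcaveDensity f) : StrictMonoOn (distFn f) (distCore f) :=
  fun _ hx _ hy hxy => hf.distFn_lt (hf.pos_of_mem_distCore hx) (hf.pos_of_mem_distCore hy) hxy

theorem isOpen_distCore (hf : LogConcaveDensity f) : IsOpen (distCore f) :=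
  (isOpen_lt continuous_const hf.continuous_distFn).inter
    (isOpen_lt hf.continuous_distFn continuous_const)

theorem ordConnected_distCore (hf : LogConcaveDensity f) : (distCore f).OrdConnected :=
  ⟨fun _ hx _ hy _ hz => ⟨hx.1.trans_le (hf.distFn_mono hz.1),
    (hf.distFn_mono hz.2).trans_lt hy.2⟩⟩

theorem support_ae_eq_distCore (hf : LogConcaveDensity f) :
    {x | 0 < f x} =ᵐ[volume] distCore f := by
  have hsub : ∀ c : ℝ, {x | 0 < f x ∧ distFn f x = c}.Subsingleton := by
    rintro c x ⟨hx, hxc⟩ y ⟨hy, hyc⟩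
    rcases lt_trichotomy x y with h | h | h
    · linarith [hf.distFn_lt hx hy h]
    · exact h
    · linarith [hf.distFn_lt hy hx h]
  have h0 := measure_eq_zero_iff_ae_notMem.1 ((hsub 0).measure_zero volume)
  have h1 := measure_eq_zero_iff_ae_notMem.1 ((hsub 1).measure_zero volume)
  filter_upwards [h0, h1] with x hx0 hx1
  refine propext ⟨fun hx => ⟨?_, ?_⟩, fun hx => hf.pos_of_mem_distCore hx⟩
  · exact lt_of_le_of_ne (hf.distFn_nonneg x) fun h => hx0 ⟨hx, h.symm⟩
  · exact lt_of_le_of_ne (hf.distFn_le_one x) fun h => hx1 ⟨hx, h⟩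

theorem setIntegral_distCore (hf : LogConcaveDensity f) {k : ℝ → ℝ}
    (hk : ∀ x, f x = 0 → k x = 0) : ∫ x in distCore f, k x = ∫ x, k x := by
  rw [← setIntegral_congr_set hf.support_ae_eq_distCore]
  refine setIntegral_eq_integral_of_forall_compl_eq_zero fun x hx => hk x ?_
  exact le_antisymm (not_lt.1 hx) (hf.nonneg x)

theorem continuousOn (hf : LogConcaveDensity f) : ContinuousOn f (distCore f) := by
  have hc : ConcaveOn ℝ (distCore f) fun x => Real.log (f x) := by
    refine ⟨hf.ordConnected_distCore.convex, fun x hx y hy a b ha hb hab => ?_⟩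
    rcases ha.eq_or_lt with rfl | ha
    · simp [show b = 1 by linarith]
    rcases hb.eq_or_lt with rfl | hb
    · simp [show a = 1 by linarith]
    have := hf.logConcave.2 x y b hb (by linarith)
    rw [show 1 - b = a by linarith] at this
    have hx := hf.pos_of_mem_distCore hx
    have hy := hf.pos_of_mem_distCore hy
    have h2 := Real.log_le_log (by positivity) this
    rw [Real.log_mul (by positivity) (by positivity), Real.log_rpow hx, Real.log_rpow hy] at h2
    simpa using h2
  refine (hc.continuousOn hf.isOpen_distCore).rexp.congr fun x hx => ?_
  exact (Real.exp_log (hf.pos_of_mem_distCore hx)).symm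

theorem hasDerivAt_distFn (hf : LogConcaveDensity f) {x : ℝ} (hx : x ∈ distCore f) :
    HasDerivAt (distFn f) (f x) x := by
  rw [hf.distFn_eq]
  refine (intervalIntegral.integral_hasDerivAt_right hf.integrable.intervalIntegrable ?_
    (hf.continuousOn.continuousAt (hf.isOpen_distCore.mem_nhds hx))).const_add _
  exact hf.integrable.aestronglyMeasurable.stronglyMeasurableAtFilter

theorem integrableOn_of_intervalIntegral_le (hf : LogConcaveDensity f) {w M : ℝ}
    (hw : w ∈ distCore f) {k : ℝ → ℝ} (hk : ContinuousOn k (distCore f))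
    (hk0 : ∀ x ∈ distCore f, 0 ≤ k x) (hM : ∀ u ∈ distCore f, u ≤ w → ∫ x in u..w, k x ≤ M) :
    IntegrableOn k (distCore f ∩ Set.Iic w) ∧ ∫ x in distCore f ∩ Set.Iic w, k x ≤ M := by
  have hpos : ∀ n : ℕ, 0 < distFn f w / (n + 2) := fun n => div_pos hw.1 (by positivity)
  have hlt : ∀ n : ℕ, distFn f w / (n + 2) < distFn f w := fun n =>
    div_lt_self hw.1 (by have : (0 : ℝ) ≤ n := n.cast_nonneg; linarith)
  choose u hu using fun n : ℕ => hf.exists_distFn_eq (hpos n) ((hlt n).trans hw.2)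
  have hmem : ∀ n, u n ∈ distCore f := fun n =>
    ⟨by rw [hu]; exact hpos n, by rw [hu]; exact (hlt n).trans hw.2⟩
  have huw : ∀ n, u n ≤ w := fun n => by
    by_contra! h
    linarith [hf.distFn_mono h.le, hu n, hlt n]
  have hsub : ∀ n, Set.Icc (u n) w ⊆ distCore f := fun n =>
    hf.ordConnected_distCore.out (hmem n) hw
  have hsub' : ∀ n, Set.Ioc (u n) w ⊆ distCore f ∩ Set.Iic w := fun n x hx =>
    ⟨hsub n (Set.Ioc_subset_Icc_self hx), hx.2⟩
  have hms : MeasurableSet (distCore f ∩ Set.Iic w) :=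
    hf.isOpen_distCore.measurableSet.inter measurableSet_Iic
  have hcov : AECover (volume.restrict (distCore f ∩ Set.Iic w)) Filter.atTop
      fun n => Set.Ioc (u n) w := by
    refine ⟨?_, fun n => measurableSet_Ioc⟩
    refine ae_restrict_of_forall_mem hms fun x hx => ?_
    have htend : Filter.Tendsto (fun n : ℕ => distFn f w / ((n : ℝ) + 2)) Filter.atTop (nhds 0) :=
      (tendsto_const_nhds (x := distFn f w)).div_atTop
        (Filter.tendsto_atTop_add_const_right _ _ tendsto_natCast_atTop_atTop)
    filter_upwards [htend.eventually_lt_const hx.1.1] with n hn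
    refine ⟨?_, hx.2⟩
    by_contra! h
    linarith [hf.distFn_mono h, hu n]
  have hres : ∀ n, (volume.restrict (distCore f ∩ Set.Iic w)).restrict (Set.Ioc (u n) w)
      = volume.restrict (Set.Ioc (u n) w) := fun n => by
    rw [Measure.restrict_restrict measurableSet_Ioc, Set.inter_eq_left.2 (hsub' n)]
  have hle : ∀ n, ∫ x in Set.Ioc (u n) w, k x ∂(volume.restrict (distCore f ∩ Set.Iic w)) ≤ M :=
    fun n => by
      rw [hres, ← intervalIntegral.integral_of_le (huw n)]
      exact hM _ (hmem n) (huw n)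
  have hint : Integrable k (volume.restrict (distCore f ∩ Set.Iic w)) := by
    refine hcov.integrable_of_integral_bounded_of_nonneg_ae M (fun n => ?_)
      (ae_restrict_of_forall_mem hms fun x hx => hk0 x hx.1) (Filter.Eventually.of_forall hle)
    rw [IntegrableOn, hres]
    exact ((hk.mono (hsub n)).integrableOn_Icc).mono_set Set.Ioc_subset_Icc_self
  exact ⟨hint, le_of_tendsto (hcov.integral_tendsto_of_countably_generated hint)
    (Filter.Eventually.of_forall hle)⟩

end LogConcaveDensity

/-- The weighted Hardy inequality on the left half-line, in terms of a density and its
distribution function. -/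
theorem LogConcaveDensity.hardy_left {f H H' : ℝ → ℝ} (hf : LogConcaveDensity f) {w M : ℝ}
    (hw : w ∈ distCore f) (hH : ∀ x ∈ distCore f, HasDerivAt H (H' x) x)
    (hH' : ContinuousOn H' (distCore f)) (hHw : H w = 0)
    (hM : ∀ u ∈ distCore f, u ≤ w → ∫ x in u..w, distFn f x ^ 2 * H' x ^ 2 / f x ≤ M) :
    IntegrableOn (fun x => f x * H x ^ 2) (distCore f ∩ Set.Iic w) ∧
      ∫ x in distCore f ∩ Set.Iic w, f x * H x ^ 2 ≤ 4 * M := by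
  have hHc : ContinuousOn H (distCore f) := fun x hx => (hH x hx).continuousAt.continuousWithinAt
  have hF := hf.continuous_distFn
  have hfc := hf.continuousOn
  have hk : ContinuousOn (fun x => f x * H x ^ 2) (distCore f) := by fun_prop
  have hq : ContinuousOn (fun x => distFn f x ^ 2 * H' x ^ 2 / f x) (distCore f) :=
    ((hF.continuousOn.pow 2).mul (hH'.pow 2)).div hfc fun x hx => (hf.pos_of_mem_distCore hx).ne'
  refine hf.integrableOn_of_intervalIntegral_le hw hk
    (fun x _ => mul_nonneg (hf.nonneg x) (sq_nonneg _)) fun u hu huw => ?_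
  have hsub : Set.Icc u w ⊆ distCore f := hf.ordConnected_distCore.out hu hw
  have hki : IntervalIntegrable (fun x => f x * H x ^ 2) volume u w :=
    ContinuousOn.intervalIntegrable_of_Icc huw (hk.mono hsub)
  have hqi : IntervalIntegrable (fun x => distFn f x ^ 2 * H' x ^ 2 / f x) volume u w :=
    ContinuousOn.intervalIntegrable_of_Icc huw (hq.mono hsub)
  have key := intervalIntegral.integral_le_sub_of_hasDeriv_right_of_le (a := u) (b := w)
    (g := fun x => distFn f x * H x ^ 2)
    (g' := fun x => f x * H x ^ 2 + distFn f x * (2 * H x * H' x))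
    (φ := fun x => 1 / 2 * (f x * H x ^ 2) - 2 * (distFn f x ^ 2 * H' x ^ 2 / f x)) huw
    ((hF.continuousOn.mul (hHc.pow 2)).mono hsub)
    (fun x hx => by
      have hx := hsub (Set.Ioo_subset_Icc_self hx)
      have h := (hf.hasDerivAt_distFn hx).mul ((hH x hx).pow 2)
      refine (h.congr_deriv ?_).hasDerivWithinAt
      norm_num)
    ((((continuousOn_const.mul hk).sub (continuousOn_const.mul hq)).mono hsub).integrableOn_Icc)
    (fun x hx => by
      have hx := hf.pos_of_mem_distCore (hsub (Set.Ioo_subset_Icc_self hx))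
      have : f x * H x ^ 2 + distFn f x * (2 * H x * H' x) -
          (1 / 2 * (f x * H x ^ 2) - 2 * (distFn f x ^ 2 * H' x ^ 2 / f x)) =
          (f x * H x + 2 * distFn f x * H' x) ^ 2 / (2 * f x) := by
        field_simp; ring
      have : 0 ≤ (f x * H x + 2 * distFn f x * H' x) ^ 2 / (2 * f x) := by positivity
      linarith)
  rw [intervalIntegral.integral_sub (hki.const_mul _) (hqi.const_mul _),
    intervalIntegral.integral_const_mul, intervalIntegral.integral_const_mul, hHw] at key
  have := mul_nonneg (hf.distFn_nonneg u) (sq_nonneg (H u))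
  linarith [hM u hu huw]

/-- The integrand of the transport deficit, as a function of the derivative of the transport
map. -/
noncomputable def transportCost (r : ℝ) : ℝ := (1 - √r) ^ 2 / (2 * √r)

theorem transportCost_nonneg (r : ℝ) : 0 ≤ transportCost r := by
  unfold transportCost; positivity

theorem continuousOn_transportCost : ContinuousOn transportCost (Set.Ioi 0) := by
  unfold transportCost
  refine ContinuousOn.div (by fun_prop) (by fun_prop) fun r hr => ?_
  have := Real.sqrt_pos.2 hr
  positivity

theorem transportCost_le {r R t : ℝ} (hR : 0 < R) (ht : 0 < t) (h1 : R * t ≤ r)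
    (h2 : r ≤ R / t) : transportCost r ≤ (√R + 1 / √R) / 2 / √t := by
  have hr : 0 < r := (mul_pos hR ht).trans_le h1
  have h1' := Real.sqrt_le_sqrt h1
  have h2' := Real.sqrt_le_sqrt h2
  rw [Real.sqrt_mul hR.le] at h1'
  rw [Real.sqrt_div hR.le] at h2'
  have hs := Real.sqrt_pos.2 hr
  have hsR := Real.sqrt_pos.2 hR
  have hst := Real.sqrt_pos.2 ht
  unfold transportCost
  have h3 : 1 / √r ≤ 1 / (√R * √t) := one_div_le_one_div_of_le (by positivity) h1'
  calc (1 - √r) ^ 2 / (2 * √r) = (√r + 1 / √r) / 2 - 1 := by field_simp; ring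
    _ ≤ (√R / √t + 1 / (√R * √t)) / 2 := by linarith
    _ = _ := by field_simp

theorem quarter_le_transportCost {r : ℝ} (hr : 0 < r) (h : r ≤ 1 / 4 ∨ 4 ≤ r) :
    1 / 4 ≤ transportCost r := by
  have hs := Real.sqrt_pos.2 hr
  have hsq := Real.sq_sqrt hr.le
  unfold transportCost
  rw [le_div_iff₀ (by positivity)]
  rcases h with h | h
  · have : √r ≤ 1 / 2 := by nlinarith
    nlinarith
  · have : 2 ≤ √r := by nlinarith
    nlinarith

theorem sq_sub_one_le_transportCost {r : ℝ} (h1 : 1 / 16 ≤ r) (h2 : r ≤ 16) :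
    (r - 1) ^ 2 ≤ 200 * transportCost r := by
  have hr : 0 < r := by linarith
  have hs := Real.sqrt_pos.2 hr
  have hsq := Real.sq_sqrt hr.le
  have hs4 : √r ≤ 4 := by nlinarith
  unfold transportCost
  rw [← mul_div_assoc, le_div_iff₀ (by positivity)]
  have h3 : (r - 1) ^ 2 = (1 - √r) ^ 2 * (√r + 1) ^ 2 := by
    rw [← hsq, Real.sqrt_sq hs.le]; ring
  rw [h3]
  have h4 : (√r + 1) ^ 2 * (2 * √r) ≤ 25 * 8 := by gcongr <;> nlinarith
  nlinarith [sq_nonneg (1 - √r)]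

/-- `T` matches the distribution functions of `f` and `g` on the interior of the support. -/
def IsTransport (f g T : ℝ → ℝ) : Prop := ∀ x ∈ distCore f, distFn g (T x) = distFn f x

namespace IsTransport

variable {f g T : ℝ → ℝ}

theorem mapsTo (hT : IsTransport f g T) {x : ℝ} (hx : x ∈ distCore f) : T x ∈ distCore g := by
  simpa only [distCore, Set.mem_ofPred_eq, hT x hx] using hx

theorem comp_neg (hf : LogConcaveDensity f) (hg : LogConcaveDensity g)
    (hT : IsTransport f g T) :
    IsTransport (fun x => f (-x)) (fun x => g (-x)) fun x => -T (-x) := fun x hx => by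
  rw [hf.distCore_comp_neg] at hx
  rw [hf.distFn_comp_neg, hg.distFn_comp_neg, neg_neg, hT _ hx]

theorem strictMonoOn (hf : LogConcaveDensity f) (hg : LogConcaveDensity g)
    (hT : IsTransport f g T) : StrictMonoOn T (distCore f) := fun x hx y hy hxy => by
  by_contra! h
  have := hg.distFn_mono h
  rw [hT x hx, hT y hy] at this
  exact this.not_gt (hf.strictMonoOn_distFn hx hy hxy)

theorem image_distCore (hf : LogConcaveDensity f) (hg : LogConcaveDensity g)
    (hT : IsTransport f g T) : T '' distCore f = distCore g := by
  refine Set.Subset.antisymm (Set.image_subset_iff.2 fun x hx => hT.mapsTo hx) fun y hy => ?_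
  obtain ⟨x, hx⟩ := hf.exists_distFn_eq hy.1 hy.2
  have hxU : x ∈ distCore f := by simpa only [distCore, Set.mem_ofPred_eq, hx] using hy
  exact ⟨x, hxU, hg.strictMonoOn_distFn.injOn (hT.mapsTo hxU) hy ((hT x hxU).trans hx)⟩

theorem continuousAt (hf : LogConcaveDensity f) (hg : LogConcaveDensity g)
    (hT : IsTransport f g T) {x : ℝ} (hx : x ∈ distCore f) : ContinuousAt T x := by
  refine (hT.strictMonoOn hf hg).continuousAt_of_image_mem_nhds
    (hf.isOpen_distCore.mem_nhds hx) ?_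
  rw [hT.image_distCore hf hg]
  exact hg.isOpen_distCore.mem_nhds (hT.mapsTo hx)

theorem hasDerivAt (hf : LogConcaveDensity f) (hg : LogConcaveDensity g)
    (hT : IsTransport f g T) {x : ℝ} (hx : x ∈ distCore f) :
    HasDerivAt T (f x / g (T x)) x := by
  have hev : ∀ᶠ y in nhdsWithin x {x}ᶜ, y ∈ distCore f ∧ T y ≠ T x := by
    filter_upwards [mem_nhdsWithin_of_mem_nhds (hf.isOpen_distCore.mem_nhds hx),
      self_mem_nhdsWithin] with y hy hyx
    exact ⟨hy, fun h => hyx ((hT.strictMonoOn hf hg).injOn hy hx h)⟩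
  have htend : Filter.Tendsto T (nhdsWithin x {x}ᶜ) (nhdsWithin (T x) {T x}ᶜ) :=
    tendsto_nhdsWithin_iff.2 ⟨(hT.continuousAt hf hg hx).tendsto.mono_left nhdsWithin_le_nhds,
      hev.mono fun y hy => hy.2⟩
  have hF := hasDerivAt_iff_tendsto_slope.1 (hf.hasDerivAt_distFn hx)
  have hG := (hasDerivAt_iff_tendsto_slope.1 (hg.hasDerivAt_distFn (hT.mapsTo hx))).comp htend
  rw [hasDerivAt_iff_tendsto_slope]
  refine (hF.div hG (hg.pos_of_mem_distCore (hT.mapsTo hx)).ne').congr' ?_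
  filter_upwards [hev, self_mem_nhdsWithin] with y ⟨hy, hne⟩ hyx
  have h1 : distFn f y - distFn f x ≠ 0 :=
    sub_ne_zero.2 fun h => hyx (hf.strictMonoOn_distFn.injOn hy hx h)
  have h2 : y - x ≠ 0 := sub_ne_zero.2 hyx
  have h3 : T y - T x ≠ 0 := sub_ne_zero.2 hne
  simp only [Function.comp, slope_def_field, Pi.div_apply, hT x hx, hT y hy]
  field_simp

theorem ratio_pos (hf : LogConcaveDensity f) (hg : LogConcaveDensity g)
    (hT : IsTransport f g T) {x : ℝ} (hx : x ∈ distCore f) : 0 < f x / g (T x) :=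
  div_pos (hf.pos_of_mem_distCore hx) (hg.pos_of_mem_distCore (hT.mapsTo hx))

theorem continuousOn (hf : LogConcaveDensity f) (hg : LogConcaveDensity g)
    (hT : IsTransport f g T) : ContinuousOn T (distCore f) := fun _ hx =>
  (hT.continuousAt hf hg hx).continuousWithinAt

theorem continuousOn_ratio (hf : LogConcaveDensity f) (hg : LogConcaveDensity g)
    (hT : IsTransport f g T) : ContinuousOn (fun x => f x / g (T x)) (distCore f) :=
  hf.continuousOn.div (hg.continuousOn.comp (hT.continuousOn hf hg) fun _ hx => hT.mapsTo hx)
    fun _ hx => (hg.pos_of_mem_distCore (hT.mapsTo hx)).ne'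

theorem continuousOn_cost (hf : LogConcaveDensity f) (hg : LogConcaveDensity g)
    (hT : IsTransport f g T) :
    ContinuousOn (fun x => f x * transportCost (f x / g (T x))) (distCore f) :=
  hf.continuousOn.mul
    (continuousOn_transportCost.comp (hT.continuousOn_ratio hf hg) fun _ hx => hT.ratio_pos hf hg hx)

end IsTransport

theorem LogConcaveDensity.le_two_mul {f : ℝ → ℝ} (hf : LogConcaveDensity f) {x y : ℝ}
    (hxy : x ≤ y) (hy : distFn f y ≤ 1 / 2) : f x ≤ 2 * f y := by
  have h1 := hf.one_sub_distFn_mul_le hxy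
  nlinarith [hf.nonneg x, mul_nonneg (hf.nonneg y) (hf.distFn_nonneg x)]

namespace IsTransport

variable {f g T : ℝ → ℝ}

theorem ratio_mul_le (hf : LogConcaveDensity f) (hg : LogConcaveDensity g)
    (hT : IsTransport f g T) {x y : ℝ} (hx : x ∈ distCore f) (hy : y ∈ distCore f) (hxy : x ≤ y)
    (hy2 : distFn f y ≤ 1 / 2) :
    f y / g (T y) * distFn f x ≤ f x / g (T x) * (2 * distFn f y) ∧
      f x / g (T x) * distFn f x ≤ f y / g (T y) * (2 * distFn f y) := by
  have hTxy := (hT.strictMonoOn hf hg).monotoneOn hx hy hxy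
  have f1 := hf.distFn_mul_le hxy
  have f2 := hf.le_two_mul hxy hy2
  have g1 := hg.distFn_mul_le hTxy
  have g2 := hg.le_two_mul hTxy (by rwa [hT y hy])
  rw [hT x hx, hT y hy] at g1
  have gx := hg.pos_of_mem_distCore (hT.mapsTo hx)
  have gy := hg.pos_of_mem_distCore (hT.mapsTo hy)
  have fx := hf.pos_of_mem_distCore hx
  have fy := hf.pos_of_mem_distCore hy
  have hFx := hx.1
  have hFy := hy.1
  constructor
  · rw [div_mul_eq_mul_div, div_mul_eq_mul_div, div_le_div_iff₀ gy gx]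
    calc f y * distFn f x * g (T x) = (distFn f x * f y) * g (T x) := by ring
      _ ≤ (f x * distFn f y) * (2 * g (T y)) := by gcongr
      _ = _ := by ring
  · rw [div_mul_eq_mul_div, div_mul_eq_mul_div, div_le_div_iff₀ gx gy]
    calc f x * distFn f x * g (T y) = f x * (distFn f x * g (T y)) := by ring
      _ ≤ (2 * f y) * (g (T x) * distFn f y) := by gcongr
      _ = _ := by ring

theorem integrableOn_cost_left (hf : LogConcaveDensity f) (hg : LogConcaveDensity g)
    (hT : IsTransport f g T) {w : ℝ} (hw : distFn f w = 1 / 2) :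
    IntegrableOn (fun x => f x * transportCost (f x / g (T x))) (distCore f ∩ Set.Iic w) := by
  have hwU : w ∈ distCore f := by
    simp only [distCore, Set.mem_ofPred_eq, hw]; norm_num
  set R := f w / g (T w) with hR
  have hRpos : 0 < R := hT.ratio_pos hf hg hwU
  set K := (√R + 1 / √R) / 2 with hK
  have hKpos : 0 < K := by positivity
  refine (hf.integrableOn_of_intervalIntegral_le (M := 2 * K) hwU (hT.continuousOn_cost hf hg)
    (fun x _ => mul_nonneg (hf.nonneg x) (transportCost_nonneg _)) fun u hu huw => ?_).1
  have hsub : Set.Icc u w ⊆ distCore f := hf.ordConnected_distCore.out hu hwU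
  have key := intervalIntegral.integral_le_sub_of_hasDeriv_right_of_le (a := u) (b := w)
    (g := fun x => 2 * K * √(distFn f x))
    (g' := fun x => 2 * K * (f x / (2 * √(distFn f x))))
    (φ := fun x => f x * transportCost (f x / g (T x))) huw
    (by have := hf.continuous_distFn; fun_prop)
    (fun x hx => by
      have hx := hsub (Set.Ioo_subset_Icc_self hx)
      exact (((hf.hasDerivAt_distFn hx).sqrt hx.1.ne').const_mul _).hasDerivWithinAt)
    (((hT.continuousOn_cost hf hg).mono hsub).integrableOn_Icc)
    (fun x hx => by
      have hxU := hsub (Set.Ioo_subset_Icc_self hx)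
      have hF := hxU.1
      obtain ⟨h1, h2⟩ := hT.ratio_mul_le hf hg hxU hwU hx.2.le hw.le
      rw [hw] at h1 h2
      have := transportCost_le hRpos hF (by linarith)
        (r := f x / g (T x)) (by rw [le_div_iff₀ hF]; linarith)
      have hs := Real.sqrt_pos.2 hF
      calc f x * transportCost (f x / g (T x)) ≤ f x * (K / √(distFn f x)) :=
            mul_le_mul_of_nonneg_left this (hf.nonneg x)
        _ = _ := by field_simp)
  have h1 : √(distFn f w) ≤ 1 := Real.sqrt_le_one.2 (hf.distFn_le_one w)
  have h2 := Real.sqrt_nonneg (distFn f u)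
  nlinarith

theorem ratio_mem_Icc (hf : LogConcaveDensity f) (hg : LogConcaveDensity g)
    (hT : IsTransport f g T) {x w ε : ℝ} (hw : distFn f w = 1 / 2) (hxw : x ≤ w)
    (hε : 0 < ε) (hx : 8 * ε < distFn f x)
    (hcost : ∫ x in distCore f ∩ Set.Iic w, f x * transportCost (f x / g (T x)) ≤ ε) :
    f x / g (T x) ∈ Set.Icc (1 / 16) 16 := by
  have hFx : 0 < distFn f x := by linarith
  have hx2 : distFn f x ≤ 1 / 2 := hw ▸ hf.distFn_mono hxw
  have hxU : x ∈ distCore f := ⟨hFx, by linarith⟩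
  obtain ⟨y, hy⟩ := hf.exists_distFn_eq (t := distFn f x / 2) (by linarith) (by linarith)
  have hyU : y ∈ distCore f := ⟨by linarith, by linarith⟩
  have hyx : y ≤ x := by
    by_contra! h
    linarith [hf.distFn_mono h.le]
  have hsub : Set.Icc y x ⊆ distCore f := hf.ordConnected_distCore.out hyU hxU
  by_contra hc
  have hpt : ∀ z ∈ Set.Icc y x, 1 / 4 * f z ≤ f z * transportCost (f z / g (T z)) := by
    intro z hz
    have hzU := hsub hz
    have hr := hT.ratio_pos hf hg hzU
    have hrx := hT.ratio_pos hf hg hxU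
    obtain ⟨h1, h2⟩ := hT.ratio_mul_le hf hg hzU hxU hz.2 hx2
    have hFz : distFn f x / 2 ≤ distFn f z := hy ▸ hf.distFn_mono hz.1
    have h3 : f x / g (T x) ≤ 4 * (f z / g (T z)) := by
      refine le_of_mul_le_mul_right ?_ hFx
      nlinarith
    have h4 : f z / g (T z) ≤ 4 * (f x / g (T x)) := by
      refine le_of_mul_le_mul_right ?_ hFx
      nlinarith
    rw [mul_comm]
    refine mul_le_mul_of_nonneg_left (quarter_le_transportCost hr ?_) (hf.nonneg z)
    by_contra! h5
    exact hc ⟨by linarith, by linarith⟩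
  have h1 := intervalIntegral.integral_mono_on hyx
    (hf.integrable.intervalIntegrable.const_mul (1 / 4))
    (ContinuousOn.intervalIntegrable_of_Icc hyx ((hT.continuousOn_cost hf hg).mono hsub)) hpt
  rw [intervalIntegral.integral_const_mul, ← hf.distFn_sub, hy,
    intervalIntegral.integral_of_le hyx] at h1
  have h2 := setIntegral_mono_set (hT.integrableOn_cost_left hf hg hw)
    (Filter.Eventually.of_forall fun z => mul_nonneg (hf.nonneg z) (transportCost_nonneg _))
    (show Set.Ioc y x ≤ᵐ[volume] (distCore f ∩ Set.Iic w : Set ℝ) from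
      Filter.Eventually.of_forall fun z hz =>
        ⟨hsub (Set.Ioc_subset_Icc_self hz), hz.2.trans hxw⟩)
  linarith

theorem integral_sq_left_le (hf : LogConcaveDensity f) (hg : LogConcaveDensity g)
    (hT : IsTransport f g T) {w ε : ℝ} (hw : distFn f w = 1 / 2)
    (hε : 0 < ε) (hε16 : ε < 1 / 16)
    (hcost : ∫ x in distCore f ∩ Set.Iic w, f x * transportCost (f x / g (T x)) ≤ ε) :
    IntegrableOn (fun x => f x * ((T x - x) - (T w - w)) ^ 2) (distCore f ∩ Set.Iic w) ∧
      ∫ x in distCore f ∩ Set.Iic w, f x * ((T x - x) - (T w - w)) ^ 2 ≤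
        4 * (562 * ε / f w ^ 2) := by
  have hwU : w ∈ distCore f := by
    simp only [distCore, Set.mem_ofPred_eq, hw]; norm_num
  have hfw := hf.pos_of_mem_distCore hwU
  refine hf.hardy_left (H' := fun x => f x / g (T x) - 1)
    hwU (fun x hx => ((hT.hasDerivAt hf hg hx).sub (hasDerivAt_id x)).sub_const _)
    ((hT.continuousOn_ratio hf hg).sub continuousOn_const) (by ring) fun u hu huw => ?_
  obtain ⟨v, hv⟩ := hf.exists_distFn_eq (t := 8 * ε) (by linarith) (by linarith)
  have hsub : Set.Icc u w ⊆ distCore f := hf.ordConnected_distCore.out hu hwU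
  have hpt : ∀ x ∈ Set.Icc u w, distFn f x ^ 2 * (f x / g (T x) - 1) ^ 2 / f x ≤
      50 / f w ^ 2 * (f x * transportCost (f x / g (T x))) +
        64 / f w ^ 2 * (Set.Iic v).indicator f x := by
    intro x hx
    have hxU := hsub hx
    have hfx := hf.pos_of_mem_distCore hxU
    have hF := hxU.1
    have hhaz := hf.distFn_mul_le hx.2
    rw [hw] at hhaz
    have hcn := transportCost_nonneg (f x / g (T x))
    have hq : distFn f x / f x ≤ 1 / 2 / f w := by
      rw [div_le_div_iff₀ hfx hfw]; linarith
    have hform : distFn f x ^ 2 * (f x / g (T x) - 1) ^ 2 / f x =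
        f x * ((distFn f x / f x) ^ 2 * (f x / g (T x) - 1) ^ 2) := by field_simp
    by_cases hxv : x ≤ v
    · rw [Set.indicator_of_mem (Set.mem_Iic.2 hxv)]
      have hR := (hT.ratio_mem_Icc hf hg hw le_rfl hε (by linarith) hcost).2
      have h2 := (hT.ratio_mul_le hf hg hxU hwU hx.2 hw.le).2
      have hgx := hg.pos_of_mem_distCore (hT.mapsTo hxU)
      have hgw := hg.pos_of_mem_distCore (hT.mapsTo hwU)
      have g1 := hg.distFn_mul_le ((hT.strictMonoOn hf hg).monotoneOn hxU hwU hx.2)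
      rw [hT x hxU, hT w hwU, hw] at g1
      have h3 : distFn f x / f x * (f x / g (T x)) ≤ 8 / f w := by
        have e : distFn f x / f x * (f x / g (T x)) = distFn f x / g (T x) := by field_simp
        rw [e, div_le_div_iff₀ hgx hfw]
        rw [div_le_iff₀ hgw] at hR
        calc distFn f x * f w ≤ distFn f x * (16 * g (T w)) := by gcongr
          _ ≤ 8 * g (T x) := by linarith
      have h4 : 1 / 2 / f w ≤ 8 / f w := by gcongr; norm_num
      have hr := hT.ratio_pos hf hg hxU
      have h5 : (distFn f x / f x * (f x / g (T x) - 1)) ^ 2 ≤ (8 / f w) ^ 2 := by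
        apply sq_le_sq'
        · have : 0 ≤ distFn f x / f x * (f x / g (T x)) := by positivity
          linarith
        · have : 0 ≤ distFn f x / f x := by positivity
          linarith
      have h6 : 0 ≤ 50 / f w ^ 2 * (f x * transportCost (f x / g (T x))) := by positivity
      rw [hform, ← mul_pow]
      calc _ ≤ f x * (8 / f w) ^ 2 := by gcongr
        _ = 64 / f w ^ 2 * f x := by ring
        _ ≤ _ := by linarith
    · rw [Set.indicator_of_notMem (mt Set.mem_Iic.1 hxv), mul_zero, add_zero, hform]
      have hFx : 8 * ε < distFn f x := by
        rw [← hv]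
        refine lt_of_le_of_ne (hf.distFn_mono (not_le.1 hxv).le) fun h => hxv ?_
        have hvU : v ∈ distCore f := ⟨by linarith, by linarith⟩
        exact (hf.strictMonoOn_distFn.injOn hvU hxU h).ge
      have hR := hT.ratio_mem_Icc hf hg hw hx.2 hε hFx hcost
      have h1 := sq_sub_one_le_transportCost hR.1 hR.2
      calc _ ≤ f x * ((1 / 2 / f w) ^ 2 * (200 * transportCost (f x / g (T x)))) := by gcongr
        _ = _ := by ring
  have hq : ContinuousOn (fun x => distFn f x ^ 2 * (f x / g (T x) - 1) ^ 2 / f x)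
      (distCore f) :=
    ((hf.continuous_distFn.continuousOn.pow 2).mul
      (((hT.continuousOn_ratio hf hg).sub continuousOn_const).pow 2)).div hf.continuousOn
      fun x hx => (hf.pos_of_mem_distCore hx).ne'
  have hci : IntervalIntegrable (fun x => f x * transportCost (f x / g (T x))) volume u w :=
    ContinuousOn.intervalIntegrable_of_Icc huw ((hT.continuousOn_cost hf hg).mono hsub)
  have hii : Integrable ((Set.Iic v).indicator f) := hf.integrable.indicator measurableSet_Iic
  have h1 := intervalIntegral.integral_mono_on huw
    (ContinuousOn.intervalIntegrable_of_Icc huw (hq.mono hsub))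
    ((hci.const_mul _).add (hii.intervalIntegrable.const_mul _)) hpt
  rw [intervalIntegral.integral_add (hci.const_mul _) (hii.intervalIntegrable.const_mul _),
    intervalIntegral.integral_const_mul, intervalIntegral.integral_const_mul] at h1
  have h2 : ∫ x in u..w, (Set.Iic v).indicator f x ≤ 8 * ε := by
    rw [intervalIntegral.integral_of_le huw, ← hv, distFn, ← integral_indicator measurableSet_Iic]
    exact setIntegral_le_integral hii
      (Filter.Eventually.of_forall (Set.indicator_nonneg fun x _ => hf.nonneg x))
  have h3 : ∫ x in u..w, f x * transportCost (f x / g (T x)) ≤ ε := by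
    rw [intervalIntegral.integral_of_le huw]
    refine le_trans (setIntegral_mono_set (hT.integrableOn_cost_left hf hg hw)
      (Filter.Eventually.of_forall fun z => mul_nonneg (hf.nonneg z) (transportCost_nonneg _))
      (Filter.Eventually.of_forall fun z hz => ?_)) hcost
    exact ⟨hsub (Set.Ioc_subset_Icc_self hz), hz.2⟩
  calc _ ≤ _ := h1
    _ ≤ 50 / f w ^ 2 * ε + 64 / f w ^ 2 * (8 * ε) := by gcongr
    _ = _ := by ring

end IsTransport

theorem LogConcaveDensity.integrableOn_sq_left {f : ℝ → ℝ} (hf : LogConcaveDensity f) {w : ℝ}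
    (hw : w ∈ distCore f) :
    IntegrableOn (fun x => f x * (x - w) ^ 2) (distCore f ∩ Set.Iic w) := by
  refine (hf.hardy_left (H' := fun _ => 1) (M := (distFn f w / f w) ^ 2 * 1) hw
    (fun x _ => (hasDerivAt_id x).sub_const w) continuousOn_const (by simp)
    fun u hu huw => ?_).1
  have hsub : Set.Icc u w ⊆ distCore f := hf.ordConnected_distCore.out hu hw
  have hfw := hf.pos_of_mem_distCore hw
  have hq : ContinuousOn (fun x => distFn f x ^ 2 * 1 ^ 2 / f x) (distCore f) :=
    ((hf.continuous_distFn.continuousOn.pow 2).mul continuousOn_const).div hf.continuousOn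
      fun x hx => (hf.pos_of_mem_distCore hx).ne'
  have h1 := intervalIntegral.integral_mono_on huw
    (ContinuousOn.intervalIntegrable_of_Icc huw (hq.mono hsub))
    (hf.integrable.intervalIntegrable.const_mul ((distFn f w / f w) ^ 2)) fun x hx => by
      have hfx := hf.pos_of_mem_distCore (hsub hx)
      have hF := (hsub hx).1
      have h2 : distFn f x / f x ≤ distFn f w / f w := by
        rw [div_le_div_iff₀ hfx hfw]; linarith [hf.distFn_mul_le hx.2]
      calc distFn f x ^ 2 * 1 ^ 2 / f x = (distFn f x / f x) ^ 2 * f x := by field_simp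
        _ ≤ _ := by gcongr
  rw [intervalIntegral.integral_const_mul, ← hf.distFn_sub] at h1
  refine h1.trans ?_
  gcongr
  linarith [hf.distFn_nonneg u, hf.distFn_le_one w]

theorem integrableOn_comp_neg_preimage {k : ℝ → ℝ} {s : Set ℝ} :
    IntegrableOn (fun x => k (-x)) (Neg.neg ⁻¹' s) ↔ IntegrableOn k s :=
  (Measure.measurePreserving_neg volume).integrableOn_comp_preimage
    (MeasurableEquiv.neg ℝ).measurableEmbedding

theorem setIntegral_comp_neg_preimage (k : ℝ → ℝ) (s : Set ℝ) :
    ∫ x in Neg.neg ⁻¹' s, k (-x) = ∫ x in s, k x :=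
  (Measure.measurePreserving_neg volume).setIntegral_preimage_emb
    (MeasurableEquiv.neg ℝ).measurableEmbedding k s

theorem inter_Iic_union_inter_Ici (s : Set ℝ) (w : ℝ) :
    (s ∩ Set.Iic w) ∪ (s ∩ Set.Ici w) = s := by
  rw [← Set.inter_union_distrib_left, Set.Iic_union_Ici, Set.inter_univ]

theorem setIntegral_eq_add_inter_Ici {k : ℝ → ℝ} {s : Set ℝ} (hs : MeasurableSet s)
    (hk : IntegrableOn k s) (w : ℝ) :
    ∫ x in s, k x = (∫ x in s ∩ Set.Iic w, k x) + ∫ x in s ∩ Set.Ici w, k x := by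
  have hd : AEDisjoint volume (s ∩ Set.Iic w) (s ∩ Set.Ici w) := by
    refine measure_mono_null (t := {w}) ?_ (measure_singleton w)
    rintro x ⟨⟨_, h1⟩, ⟨_, h2⟩⟩
    exact le_antisymm h1 h2
  have := setIntegral_union₀ hd (hs.inter measurableSet_Ici).nullMeasurableSet
    (hk.mono_set Set.inter_subset_left) (hk.mono_set Set.inter_subset_left)
  rwa [inter_Iic_union_inter_Ici] at this

theorem LogConcaveDensity.distCore_comp_neg_inter_Iic {f : ℝ → ℝ} (hf : LogConcaveDensity f)
    (w : ℝ) : distCore (fun x => f (-x)) ∩ Set.Iic (-w) =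
      Neg.neg ⁻¹' (distCore f ∩ Set.Ici w) := by
  rw [hf.distCore_comp_neg, Set.preimage_inter]
  congr 1
  ext x
  simp

theorem LogConcaveDensity.integrableOn_sq {f : ℝ → ℝ} (hf : LogConcaveDensity f) {w : ℝ}
    (hw : w ∈ distCore f) : IntegrableOn (fun x => f x * (x - w) ^ 2) (distCore f) := by
  rw [← inter_Iic_union_inter_Ici (distCore f) w]
  refine (hf.integrableOn_sq_left hw).union ?_
  have := hf.comp_neg.integrableOn_sq_left (w := -w) (by
    rw [hf.distCore_comp_neg]; simpa using hw)
  rw [hf.distCore_comp_neg_inter_Iic] at this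
  rw [← integrableOn_comp_neg_preimage]
  refine this.congr_fun_ae (Filter.Eventually.of_forall fun x => ?_)
  ring

namespace IsTransport

variable {f g T : ℝ → ℝ}

theorem integrableOn_cost (hf : LogConcaveDensity f) (hg : LogConcaveDensity g)
    (hT : IsTransport f g T) {w : ℝ} (hw : distFn f w = 1 / 2) :
    IntegrableOn (fun x => f x * transportCost (f x / g (T x))) (distCore f) := by
  rw [← inter_Iic_union_inter_Ici (distCore f) w]
  refine (hT.integrableOn_cost_left hf hg hw).union ?_
  have := (hT.comp_neg hf hg).integrableOn_cost_left hf.comp_neg hg.comp_neg (w := -w) (by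
    rw [hf.distFn_comp_neg, neg_neg, hw]; norm_num)
  rw [hf.distCore_comp_neg_inter_Iic] at this
  rw [← integrableOn_comp_neg_preimage]
  simpa only [neg_neg] using this

theorem integral_sq_le (hf : LogConcaveDensity f) (hg : LogConcaveDensity g)
    (hT : IsTransport f g T) {w ε : ℝ} (hw : distFn f w = 1 / 2)
    (hε : 0 < ε) (hε16 : ε < 1 / 16)
    (hcost : ∫ x in distCore f, f x * transportCost (f x / g (T x)) ≤ ε) :
    IntegrableOn (fun x => f x * ((T x - x) - (T w - w)) ^ 2) (distCore f) ∧
      ∫ x in distCore f, f x * ((T x - x) - (T w - w)) ^ 2 ≤ 2 ^ 13 * ε / f w ^ 2 := by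
  have hci := hT.integrableOn_cost hf hg hw
  have hms := hf.isOpen_distCore.measurableSet
  have hcost0 : ∀ s : Set ℝ, 0 ≤ ∫ x in s, f x * transportCost (f x / g (T x)) := fun s =>
    integral_nonneg fun x => mul_nonneg (hf.nonneg x) (transportCost_nonneg _)
  have hsplit := setIntegral_eq_add_inter_Ici hms hci w
  obtain ⟨hl, hl'⟩ := hT.integral_sq_left_le hf hg hw hε hε16
    (by linarith [hcost0 (distCore f ∩ Set.Ici w)])
  have hr := (hT.comp_neg hf hg).integral_sq_left_le hf.comp_neg hg.comp_neg (w := -w) (ε := ε)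
    (by rw [hf.distFn_comp_neg, neg_neg, hw]; norm_num) hε hε16
  simp only [hf.distCore_comp_neg_inter_Iic, neg_neg] at hr
  have hsq : ∀ x, f (-x) * (-T (-x) - x - (-T w - -w)) ^ 2 =
      f (-x) * (T (-x) - -x - (T w - w)) ^ 2 := fun x => by ring
  simp only [hsq] at hr
  rw [setIntegral_comp_neg_preimage (fun x => f x * transportCost (f x / g (T x))),
    setIntegral_comp_neg_preimage (fun x => f x * (T x - x - (T w - w)) ^ 2),
    integrableOn_comp_neg_preimage (k := fun x => f x * (T x - x - (T w - w)) ^ 2)] at hr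
  obtain ⟨hr, hr'⟩ := hr (by linarith [hcost0 (distCore f ∩ Set.Iic w)])
  have hi := hl.union hr
  rw [inter_Iic_union_inter_Ici] at hi
  refine ⟨hi, ?_⟩
  rw [setIntegral_eq_add_inter_Ici hms hi w]
  calc _ ≤ 4 * (562 * ε / f w ^ 2) + 4 * (562 * ε / f w ^ 2) := add_le_add hl' hr'
    _ = 4496 * ε / f w ^ 2 := by ring
    _ ≤ _ := by gcongr; norm_num

theorem integral_mul_eq (hf : LogConcaveDensity f) (hg : LogConcaveDensity g)
    (hT : IsTransport f g T) : ∫ x in distCore f, T x * f x = ∫ y, y * g y := by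
  have h := integral_image_eq_integral_abs_deriv_smul hf.isOpen_distCore.measurableSet
    (fun x hx => (hT.hasDerivAt hf hg hx).hasDerivWithinAt)
    (hT.strictMonoOn hf hg).injOn fun y => y * g y
  rw [hT.image_distCore hf hg, hg.setIntegral_distCore fun x hx => by simp [hx]] at h
  rw [h]
  refine setIntegral_congr_fun hf.isOpen_distCore.measurableSet fun x hx => ?_
  have := hg.pos_of_mem_distCore (hT.mapsTo hx)
  simp only [abs_of_pos (hT.ratio_pos hf hg hx), smul_eq_mul]
  field_simp

end IsTransport

/-- Centering a function at its mean decreases its second moment. -/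
theorem LogConcaveDensity.integral_mul_sq_le {f h : ℝ → ℝ} (hf : LogConcaveDensity f)
    (hh : IntegrableOn (fun x => f x * h x) (distCore f))
    (h0 : ∫ x in distCore f, f x * h x = 0) (c : ℝ)
    (hc : IntegrableOn (fun x => f x * (h x - c) ^ 2) (distCore f)) :
    ∫ x in distCore f, f x * h x ^ 2 ≤ ∫ x in distCore f, f x * (h x - c) ^ 2 := by
  have e : ∀ x, f x * h x ^ 2 = f x * (h x - c) ^ 2 + 2 * c * (f x * h x) - c ^ 2 * f x :=
    fun x => by ring
  have hfi : IntegrableOn f (distCore f) := hf.integrable.integrableOn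
  have h1 : ∫ x in distCore f, f x = 1 := by
    rw [hf.setIntegral_distCore fun x hx => hx, hf.integral_eq_one]
  simp only [e]
  have hhc := hh.const_mul (2 * c)
  have hsum : IntegrableOn (fun x => f x * (h x - c) ^ 2 + 2 * c * (f x * h x)) (distCore f) :=
    hc.add hhc
  rw [integral_sub hsum (hfi.const_mul _), integral_add hc hhc,
    integral_const_mul, integral_const_mul, h0, h1]
  nlinarith [sq_nonneg c]

theorem LogConcaveDensity.integrableOn_mul_of_sq {f h : ℝ → ℝ} (hf : LogConcaveDensity f)
    (hhc : ContinuousOn h (distCore f)) (c : ℝ)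
    (hc : IntegrableOn (fun x => f x * (h x - c) ^ 2) (distCore f)) :
    IntegrableOn (fun x => f x * h x) (distCore f) := by
  have hfi : IntegrableOn f (distCore f) := hf.integrable.integrableOn
  refine Integrable.mono' ((hfi.const_mul (1 + |c|)).add hc)
    ((hf.continuousOn.mul hhc).aestronglyMeasurable hf.isOpen_distCore.measurableSet)
    (Filter.Eventually.of_forall fun x => ?_)
  have h1 : |h x| ≤ 1 + |c| + (h x - c) ^ 2 := by
    have h2 := abs_sub_abs_le_abs_sub (h x) c
    nlinarith [sq_abs (h x - c), sq_nonneg (|h x - c| - 1)]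
  rw [Real.norm_eq_abs, abs_mul, abs_of_nonneg (hf.nonneg x)]
  calc f x * |h x| ≤ f x * (1 + |c| + (h x - c) ^ 2) :=
        mul_le_mul_of_nonneg_left h1 (hf.nonneg x)
    _ = _ := by simp only [Pi.add_apply]; ring

theorem transport_distance_estimate
    (f g : ℝ → ℝ) (T T' : ℝ → ℝ) (wf ε : ℝ)
    (hf : LogConcaveFn f) (hg : LogConcaveFn g)
    (hfi : Integrable f) (hgi : Integrable g)
    (hf1 : ∫ x, f x = 1) (hg1 : ∫ x, g x = 1)
    (hfmean : ∫ x, x * f x = 0) (hgmean : ∫ y, y * g y = 0)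
    (hwf : ∫ x in Set.Iic wf, f x = 1 / 2) (hwfpos : 0 < f wf)
    (hT : ∀ x ∈ {x : ℝ | 0 < f x}, ∫ t in Set.Iic x, f t = ∫ t in Set.Iic (T x), g t)
    (hTmono : MonotoneOn T {x : ℝ | 0 < f x})
    (hderiv : ∀ᵐ x, x ∈ {x : ℝ | 0 < f x} →
      HasDerivAt T (T' x) x ∧ f x = g (T x) * T' x)
    (hε : 0 < ε) (hε48 : ε < 1 / 48)
    (hstab : ∫ x in {x : ℝ | 0 < f x},
        f x * (1 - Real.sqrt (T' x)) ^ 2 / (2 * Real.sqrt (T' x)) ≤ ε) :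
    ∫ x in {x : ℝ | 0 < f x}, f x * (T x - x) ^ 2 ≤
      2 ^ 20 / f wf ^ 2 * (ε * |Real.log ε| ^ 2) := by
  have df : LogConcaveDensity f := ⟨hf, hfi, hf1⟩
  have dg : LogConcaveDensity g := ⟨hg, hgi, hg1⟩
  have tr : IsTransport f g T := fun x hx => (hT x (df.pos_of_mem_distCore hx)).symm
  have hms := df.isOpen_distCore.measurableSet
  have hw : wf ∈ distCore f := by
    simp only [distCore, Set.mem_ofPred_eq, distFn, hwf]; norm_num
  rw [setIntegral_congr_set df.support_ae_eq_distCore] at hstab ⊢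
  have hcost : ∫ x in distCore f, f x * transportCost (f x / g (T x)) ≤ ε := by
    refine le_of_eq_of_le (setIntegral_congr_ae hms ?_) hstab
    filter_upwards [hderiv] with x hx hxU
    have hgx := dg.pos_of_mem_distCore (tr.mapsTo hxU)
    have hT'x : T' x = f x / g (T x) := by
      rw [eq_div_iff hgx.ne', mul_comm]
      exact (hx (df.pos_of_mem_distCore hxU)).2.symm
    rw [hT'x, transportCost, mul_div_assoc]
  obtain ⟨hsq, hle⟩ := tr.integral_sq_le df dg hwf hε (by linarith) hcost
  have hcT := tr.continuousOn df dg
  have hid : IntegrableOn (fun x => f x * x) (distCore f) :=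
    df.integrableOn_mul_of_sq continuousOn_id wf (df.integrableOn_sq hw)
  have hh : IntegrableOn (fun x => f x * (T x - x)) (distCore f) :=
    df.integrableOn_mul_of_sq (h := fun x => T x - x) (hcT.sub continuousOn_id) (T wf - wf) hsq
  have hTi : IntegrableOn (fun x => T x * f x) (distCore f) :=
    (hh.add hid).congr_fun (fun x _ => by simp only [Pi.add_apply]; ring) hms
  have h0 : ∫ x in distCore f, f x * (T x - x) = 0 := by
    have e : ∀ x, f x * (T x - x) = T x * f x - f x * x := fun x => by ring
    have hx : ∫ x in distCore f, f x * x = 0 := by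
      rw [df.setIntegral_distCore fun x hx => by simp [hx], ← hfmean]
      simp only [mul_comm]
    simp only [e]
    rw [integral_sub hTi hid, tr.integral_mul_eq df dg, hgmean, hx, sub_zero]
  have hlog : 1 ≤ |Real.log ε| := by
    have h1 : Real.log ε ≤ -1 := by
      rw [Real.log_le_iff_le_exp hε, Real.exp_neg]
      refine hε48.le.trans ?_
      have := Real.exp_one_lt_d9
      rw [le_inv_comm₀ (by norm_num) (Real.exp_pos 1)]
      norm_num
      linarith
    rw [abs_of_neg (by linarith)]
    linarith
  calc _ ≤ ∫ x in distCore f, f x * (T x - x - (T wf - wf)) ^ 2 :=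
        df.integral_mul_sq_le hh h0 (T wf - wf) hsq
    _ ≤ 2 ^ 13 * ε / f wf ^ 2 := hle
    _ = 2 ^ 13 / f wf ^ 2 * (ε * 1) := by ring
    _ ≤ 2 ^ 20 / f wf ^ 2 * (ε * |Real.log ε| ^ 2) := by
        gcongr
        · norm_num
        · norm_num
        · exact one_le_pow₀ hlog
end

section
/- Let f, g be log-concave probability densities on ℝ with ∫_{−∞}^{z} f ≥ ν and ∫_{z}^{∞} f ≥ ν for some ν > 0 and z ∈ ℝ, and suppose ∫_{z}^{∞} g ≤ ν/2 or ∫_{−∞}^{z} g ≤ ν/2. Then there is an absolute constant c > 0 such that ∫_{z−ν/f(z)}^{z+ν/f(z)} (T(x) − x)² f(x) dx ≥ c·ν³/f(z)², where T is the transportation map from f to g. -/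
open MeasureTheory

lemma LogConcaveFn.comp_neg {h : ℝ → ℝ} (hh : LogConcaveFn h) :
    LogConcaveFn fun x => h (-x) := by
  refine ⟨fun x => hh.1 _, fun x y l h0 h1 => ?_⟩
  have := hh.2 (-x) (-y) l h0 h1
  rwa [show (1 - l) * -x + l * -y = -((1 - l) * x + l * y) by ring] at this

lemma LogConcaveFn.pos_of_mem_Icc_s17 {h : ℝ → ℝ} (hh : LogConcaveFn h) {x y w : ℝ}
    (hx : 0 < h x) (hy : 0 < h y) (hw : w ∈ Set.Icc x y) : 0 < h w := by
  rcases hw.1.eq_or_lt with rfl | h1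
  · exact hx
  rcases hw.2.eq_or_lt with rfl | h2
  · exact hy
  have hxy : 0 < y - x := by linarith
  have := hh.2 x y ((w - x) / (y - x)) (div_pos (by linarith) hxy)
    ((div_lt_one hxy).2 (by linarith))
  rw [show (1 - (w - x) / (y - x)) * x + (w - x) / (y - x) * y = w by field_simp; ring] at this
  exact lt_of_lt_of_le (by positivity) this

lemma LogConcaveFn.ordConnected_support {h : ℝ → ℝ} (hh : LogConcaveFn h) :
    Set.OrdConnected {x | 0 < h x} :=
  ⟨fun _ hx _ hy _ hw => hh.pos_of_mem_Icc_s17 hx hy hw⟩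

/-- Once a log-concave function has dropped by a factor `e` over `[p, q]`, it keeps decaying
at least at that exponential rate. -/
lemma LogConcaveFn.le_mul_exp {h : ℝ → ℝ} (hh : LogConcaveFn h) {p q : ℝ} (hpq : p < q)
    (hd : h q * Real.exp 1 < h p) {x : ℝ} (hx : q ≤ x) :
    h x ≤ h q * Real.exp (-(x - q) / (q - p)) := by
  rcases hx.eq_or_lt with rfl | hx
  · simp
  have hqp : 0 < q - p := by linarith
  have hxp : 0 < x - p := by linarith
  rcases (hh.1 x).eq_or_lt with h0 | hxpos
  · rw [← h0]; have := hh.1 q; positivity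
  have hppos : 0 < h p := lt_of_le_of_lt (mul_nonneg (hh.1 q) (Real.exp_nonneg 1)) hd
  have hqpos : 0 < h q := hh.pos_of_mem_Icc_s17 hppos hxpos ⟨hpq.le, hx.le⟩
  have key := hh.2 p x ((q - p) / (x - p)) (div_pos hqp hxp) ((div_lt_one hxp).2 (by linarith))
  rw [show (1 - (q - p) / (x - p)) * p + (q - p) / (x - p) * x = q by field_simp; ring] at key
  have hlog := Real.log_le_log (by positivity) key
  rw [Real.log_mul (by positivity) (by positivity), Real.log_rpow hppos, Real.log_rpow hxpos]
    at hlog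
  have hd' := Real.log_le_log (by positivity) hd.le
  rw [Real.log_mul (by positivity) (by positivity), Real.log_exp] at hd'
  rw [← Real.log_le_log_iff hxpos (by positivity), Real.log_mul (by positivity) (by positivity),
    Real.log_exp]
  have e1 : (1 - (q - p) / (x - p)) = (x - q) / (x - p) := by field_simp; ring
  rw [e1] at hlog
  have h2 : (x - q) * Real.log (h p) + (q - p) * Real.log (h x) ≤ (x - p) * Real.log (h q) := by
    have := mul_le_mul_of_nonneg_left hlog hxp.le
    field_simp at this
    linarith
  have h3 : (q - p) * Real.log (h x) ≤ (q - p) * Real.log (h q) - (x - q) := by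
    nlinarith
  have h4 : (q - p) * Real.log (h x) ≤ (q - p) * (Real.log (h q) + -(x - q) / (q - p)) := by
    rw [mul_add, mul_div_cancel₀ _ hqp.ne']; linarith
  exact le_of_mul_le_mul_left h4 hqp

lemma LogConcaveFn.integral_Ioi_le {h : ℝ → ℝ} (hh : LogConcaveFn h) {p q : ℝ} (hpq : p < q)
    (hd : h q * Real.exp 1 < h p) (hi : Integrable h) :
    ∫ x in Set.Ioi q, h x ≤ h q * (q - p) := by
  have hqp : 0 < q - p := by linarith
  have ha : -(q - p)⁻¹ < 0 := by simpa using hqp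
  have hint := integrableOn_exp_mul_Ioi ha q
  have heq : ∀ x, h q * Real.exp (-(x - q) / (q - p)) =
      h q * Real.exp (q / (q - p)) * Real.exp (-(q - p)⁻¹ * x) := fun x => by
    rw [mul_assoc, ← Real.exp_add]; congr 2; field_simp; ring
  calc ∫ x in Set.Ioi q, h x
      ≤ ∫ x in Set.Ioi q, h q * Real.exp (q / (q - p)) * Real.exp (-(q - p)⁻¹ * x) := by
        refine setIntegral_mono_on hi.integrableOn (hint.const_mul _) measurableSet_Ioi ?_
        intro x hx
        rw [← heq]
        exact hh.le_mul_exp hpq hd (le_of_lt hx)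
    _ = h q * (q - p) := by
        rw [integral_const_mul, integral_exp_mul_Ioi ha, mul_assoc, mul_div_assoc', mul_neg,
          ← Real.exp_add, show q / (q - p) + -(q - p)⁻¹ * q = 0 by field_simp; ring,
          Real.exp_zero]
        field_simp

lemma MeasureTheory.Integrable.exists_lt_mul_exp_lt {h : ℝ → ℝ} (hi : Integrable h)
    {p : ℝ} (hp : 0 < h p) : ∃ q, p < q ∧ h q * Real.exp 1 < h p := by
  by_contra! hcon
  have hc : IntegrableOn (fun _ : ℝ => h p / Real.exp 1) (Set.Ioi p) := by
    refine Integrable.mono' hi.integrableOn (by fun_prop) ?_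
    filter_upwards [ae_restrict_mem measurableSet_Ioi] with x hx
    rw [Real.norm_of_nonneg (by positivity)]
    exact (div_le_iff₀ (Real.exp_pos 1)).2 (hcon x hx)
  rw [integrableOn_const_iff] at hc
  simp [hp.ne'] at hc

lemma LogConcaveFn.integrableOn_Ioi_sq_mul {h : ℝ → ℝ} (hh : LogConcaveFn h)
    (hi : Integrable h) : IntegrableOn (fun x => x ^ 2 * h x) (Set.Ioi 0) := by
  by_cases h0 : ∀ x, h x = 0
  · simp [h0]
  push Not at h0
  obtain ⟨p, hp⟩ := h0
  obtain ⟨q, hpq, hd⟩ := hi.exists_lt_mul_exp_lt ((hh.1 p).lt_of_ne' hp)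
  have hqp : 0 < q - p := by linarith
  have hm : AEStronglyMeasurable (fun x => x ^ 2 * h x) volume :=
    (by fun_prop : Continuous fun x : ℝ => x ^ 2).aestronglyMeasurable.mul hi.1
  have hfar : IntegrableOn (fun x => x ^ 2 * h x) (Set.Ioi q) := by
    have hb : 0 < (q - p)⁻¹ := by positivity
    have hint : IntegrableOn (fun x : ℝ => x ^ 2 * Real.exp (-(q - p)⁻¹ * x)) (Set.Ioi q) := by
      refine integrable_of_isBigO_exp_neg (half_pos hb) (by fun_prop) ?_
      have := (isLittleO_pow_exp_pos_mul_atTop 2 (half_pos hb)).isBigO.mul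
        (Asymptotics.isBigO_refl (fun x : ℝ => Real.exp (-(q - p)⁻¹ * x)) Filter.atTop)
      refine this.congr_right fun x => ?_
      rw [← Real.exp_add]; congr 1; ring
    refine Integrable.mono' (hint.const_mul (h q * Real.exp (q / (q - p)))) hm.restrict ?_
    filter_upwards [ae_restrict_mem measurableSet_Ioi] with x hx
    have h1 := hh.le_mul_exp hpq hd (le_of_lt hx)
    have heq : h q * Real.exp (-(x - q) / (q - p)) =
        h q * Real.exp (q / (q - p)) * Real.exp (-(q - p)⁻¹ * x) := by
      rw [mul_assoc, ← Real.exp_add]; congr 2; field_simp; ring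
    rw [heq] at h1
    rw [Real.norm_of_nonneg (mul_nonneg (sq_nonneg x) (hh.1 x))]
    have := mul_le_mul_of_nonneg_left h1 (sq_nonneg x)
    linarith
  have hnear : IntegrableOn (fun x => x ^ 2 * h x) (Set.Ioc 0 q) := by
    refine Integrable.mono' (hi.integrableOn.const_mul (q ^ 2)) hm.restrict ?_
    filter_upwards [ae_restrict_mem measurableSet_Ioc] with x hx
    rw [Real.norm_of_nonneg (mul_nonneg (sq_nonneg x) (hh.1 x))]
    exact mul_le_mul_of_nonneg_right (pow_le_pow_left₀ hx.1.le hx.2 2) (hh.1 x)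
  refine (hnear.union hfar).mono_set fun x hx => ?_
  rcases le_or_gt x q with hxq | hxq
  · exact Or.inl ⟨hx, hxq⟩
  · exact Or.inr hxq

lemma LogConcaveFn.integrable_sq_mul {h : ℝ → ℝ} (hh : LogConcaveFn h)
    (hi : Integrable h) : Integrable fun x => x ^ 2 * h x := by
  have h1 := hh.integrableOn_Ioi_sq_mul hi
  have h2 := hh.comp_neg.integrableOn_Ioi_sq_mul hi.comp_neg
  have h3 : IntegrableOn (fun x => x ^ 2 * h x) (Set.Iic 0) := by
    rw [← integrableOn_Ici_iff_integrableOn_Ioi] at h2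
    have := IntegrableOn.comp_neg_Iic (c := (0 : ℝ)) (neg_zero (G := ℝ) ▸ h2)
    simpa using this
  simpa using h3.union h1

lemma measure_setOf_measure_Iic_le (μ : Measure ℝ) [IsFiniteMeasure μ] (s : ENNReal) :
    μ {x | μ (Set.Iic x) ≤ s} ≤ s := by
  have hA : MeasurableSet {x | μ (Set.Iic x) ≤ s} :=
    Set.OrdConnected.measurableSet ⟨fun _ _ _ hy _ hw =>
      (measure_mono (Set.Iic_subset_Iic.2 hw.2)).trans hy⟩
  rw [hA.measure_eq_iSup_isCompact]
  refine iSup_le fun K => iSup_le fun hK => iSup_le fun hc => ?_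
  rcases K.eq_empty_or_nonempty with rfl | hne
  · simp
  obtain ⟨x, hx, hmax⟩ := hc.exists_isGreatest hne
  exact (measure_mono hmax).trans (hK hx)

lemma measure_setOf_le_measure_Iic (μ : Measure ℝ) [IsProbabilityMeasure μ] [NullSingletonClass μ]
    (s : ENNReal) : μ {x | s ≤ μ (Set.Iic x)} ≤ 1 - s := by
  have hA : MeasurableSet {x | s ≤ μ (Set.Iic x)} :=
    Set.OrdConnected.measurableSet ⟨fun _ hx _ _ _ hw =>
      le_trans hx (measure_mono (Set.Iic_subset_Iic.2 hw.1))⟩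
  rw [hA.measure_eq_iSup_isCompact]
  refine iSup_le fun K => iSup_le fun hK => iSup_le fun hc => ?_
  rcases K.eq_empty_or_nonempty with rfl | hne
  · simp
  obtain ⟨x, hx, hmin⟩ := hc.exists_isLeast hne
  calc μ K ≤ μ (Set.Ici x) := measure_mono hmin
    _ = μ (Set.Iic x)ᶜ := by rw [Set.compl_Iic, measure_congr Ioi_ae_eq_Ici]
    _ = 1 - μ (Set.Iic x) := prob_compl_eq_one_sub measurableSet_Iic
    _ ≤ 1 - s := tsub_le_tsub_left (hK hx) 1

/-- A map matching the distribution functions of an atomless `μ` and of `ρ` pushes `μ` to `ρ`. -/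
lemma map_eq_of_measure_Iic_eq (μ ρ : Measure ℝ) [IsProbabilityMeasure μ] [NullSingletonClass μ]
    [IsProbabilityMeasure ρ] {T : ℝ → ℝ} (hT : AEMeasurable T μ)
    (h : ∀ᵐ x ∂μ, μ (Set.Iic x) = ρ (Set.Iic (T x))) : μ.map T = ρ := by
  have := Measure.isProbabilityMeasure_map hT
  refine Measure.ext_of_Iic _ _ fun t => le_antisymm ?_ ?_
  · rw [Measure.map_apply_of_aemeasurable hT measurableSet_Iic]
    refine le_trans (measure_mono_ae ?_) (measure_setOf_measure_Iic_le μ (ρ (Set.Iic t)))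
    filter_upwards [h] with x hx hxt
    change μ (Set.Iic x) ≤ ρ (Set.Iic t)
    rw [hx]
    exact measure_mono (Set.Iic_subset_Iic.2 hxt)
  · have hle : (μ.map T) (Set.Iic t)ᶜ ≤ 1 - ρ (Set.Iic t) := by
      rw [Measure.map_apply_of_aemeasurable hT measurableSet_Iic.compl]
      refine le_trans (measure_mono_ae ?_) (measure_setOf_le_measure_Iic μ (ρ (Set.Iic t)))
      filter_upwards [h] with x hx hxt
      change ρ (Set.Iic t) ≤ μ (Set.Iic x)
      rw [hx]
      exact measure_mono (Set.Iic_subset_Iic.2 (le_of_not_ge fun hle => hxt hle))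
    rw [prob_compl_eq_one_sub measurableSet_Iic] at hle
    exact (ENNReal.sub_le_sub_iff_left prob_le_one ENNReal.one_ne_top).1 hle

lemma withDensity_ofReal_apply {h : ℝ → ℝ} (h0 : ∀ x, 0 ≤ h x) (hi : Integrable h) (s : Set ℝ) :
    (volume.withDensity fun x => ENNReal.ofReal (h x)) s = ENNReal.ofReal (∫ x in s, h x) := by
  rw [withDensity_apply', ofReal_integral_eq_lintegral_ofReal hi.integrableOn
    (Filter.Eventually.of_forall h0)]

lemma isProbabilityMeasure_withDensity_ofReal {h : ℝ → ℝ} (h0 : ∀ x, 0 ≤ h x)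
    (hi : Integrable h) (h1 : ∫ x, h x = 1) :
    IsProbabilityMeasure (volume.withDensity fun x => ENNReal.ofReal (h x)) :=
  ⟨by rw [withDensity_ofReal_apply h0 hi, setIntegral_univ, h1, ENNReal.ofReal_one]⟩

lemma integrable_withDensity_ofReal_iff {h φ : ℝ → ℝ} (h0 : ∀ x, 0 ≤ h x) (hi : Integrable h) :
    Integrable φ (volume.withDensity fun x => ENNReal.ofReal (h x)) ↔
      Integrable fun x => φ x * h x := by
  rw [integrable_withDensity_iff_integrable_smul₀' hi.1.aemeasurable.ennreal_ofReal (by simp)]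
  simp [ENNReal.toReal_ofReal, h0, mul_comm]

lemma integrable_transport_cost {f g T : ℝ → ℝ} (hf : LogConcaveFn f) (hg : LogConcaveFn g)
    (hfi : Integrable f) (hgi : Integrable g) (hf1 : ∫ x, f x = 1) (hg1 : ∫ x, g x = 1)
    (hT : ∀ x ∈ {x : ℝ | 0 < f x}, ∫ t in Set.Iic x, f t = ∫ t in Set.Iic (T x), g t)
    (hTc : ContinuousOn T {x : ℝ | 0 < f x}) :
    Integrable fun x => (T x - x) ^ 2 * f x := by
  set μ := volume.withDensity fun x => ENNReal.ofReal (f x) with hμ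
  set ρ := volume.withDensity fun x => ENNReal.ofReal (g x) with hρ
  have : IsProbabilityMeasure μ := isProbabilityMeasure_withDensity_ofReal hf.1 hfi hf1
  have : IsProbabilityMeasure ρ := isProbabilityMeasure_withDensity_ofReal hg.1 hgi hg1
  have hS : MeasurableSet {x : ℝ | 0 < f x} := hf.ordConnected_support.measurableSet
  have hae : ∀ᵐ x ∂μ, x ∈ {x : ℝ | 0 < f x} := by
    rw [hμ, ae_withDensity_iff' hfi.1.aemeasurable.ennreal_ofReal]
    exact Filter.Eventually.of_forall fun x hx => by simpa using hx
  have hTm : AEMeasurable T μ := by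
    have := hTc.aemeasurable (μ := μ) hS
    rwa [Measure.restrict_eq_self_of_ae_mem hae] at this
  have hmap : μ.map T = ρ := by
    refine map_eq_of_measure_Iic_eq μ ρ hTm ?_
    filter_upwards [hae] with x hx
    rw [hμ, hρ, withDensity_ofReal_apply hf.1 hfi, withDensity_ofReal_apply hg.1 hgi, hT x hx]
  have hsq : Integrable (fun x => T x ^ 2) μ := by
    have h2 : Integrable (fun y : ℝ => y ^ 2) (μ.map T) := by
      rw [hmap, integrable_withDensity_ofReal_iff hg.1 hgi]
      exact hg.integrable_sq_mul hgi
    exact h2.comp_aemeasurable hTm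
  have hid : Integrable (fun x => x ^ 2) μ :=
    (integrable_withDensity_ofReal_iff hf.1 hfi).2 (hf.integrable_sq_mul hfi)
  have hL : MemLp (fun x => T x - x) 2 μ :=
    ((memLp_two_iff_integrable_sq hTm.aestronglyMeasurable).2 hsq).sub
      ((memLp_two_iff_integrable_sq (by fun_prop)).2 hid)
  exact (integrable_withDensity_ofReal_iff hf.1 hfi).1 hL.integrable_sq

lemma LogConcaveFn.le_three_mul {f : ℝ → ℝ} (hf : LogConcaveFn f) (hfi : Integrable f)
    {ν z : ℝ} (hz : 0 < f z) (hl : ν ≤ ∫ t in Set.Iic z, f t) {x : ℝ} (hzx : z ≤ x)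
    (hx : f z * (x - z) < ν) : f x ≤ 3 * f z := by
  by_contra! hcon
  have hlt : z < x := hzx.lt_of_ne (by rintro rfl; linarith)
  have he : f z * Real.exp 1 < f x := by nlinarith [Real.exp_one_lt_three]
  have := hf.comp_neg.integral_Ioi_le (p := -x) (q := -z) (by linarith) (by simpa using he)
    hfi.comp_neg
  rw [integral_comp_neg_Ioi] at this
  simp only [neg_neg] at this
  linarith

lemma LogConcaveFn.integral_Ioc_le {f : ℝ → ℝ} (hf : LogConcaveFn f) (hfi : Integrable f)
    {ν z : ℝ} (hz : 0 < f z) (hl : ν ≤ ∫ t in Set.Iic z, f t) {x : ℝ} (hzx : z ≤ x)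
    (hx : f z * (x - z) < ν) : ∫ t in Set.Ioc z x, f t ≤ 3 * (f z * (x - z)) := by
  calc ∫ t in Set.Ioc z x, f t ≤ ∫ t in Set.Ioc z x, 3 * f z :=
        setIntegral_mono_on hfi.integrableOn (integrableOn_const (by simp)) measurableSet_Ioc fun t ht =>
          hf.le_three_mul hfi hz hl ht.1.le (by nlinarith [ht.2])
    _ = 3 * (f z * (x - z)) := by
        simp [hzx]; ring

lemma LogConcaveFn.le_three_mul_of_integral_Ioi {f : ℝ → ℝ} (hf : LogConcaveFn f)
    (hfi : Integrable f) {ν z : ℝ} (hz : 0 < f z) (hl : ν ≤ ∫ t in Set.Iic z, f t)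
    (hr : ν ≤ ∫ t in Set.Ioi z, f t) {x : ℝ} (hzx : z ≤ x) (hx : 4 * (f z * (x - z)) < ν) :
    f z ≤ 3 * f x := by
  by_contra! hcon
  have hlt : z < x := hzx.lt_of_ne (by rintro rfl; linarith)
  have hpos : 0 < f z * (x - z) := mul_pos hz (by linarith)
  have he : f x * Real.exp 1 < f z := by
    nlinarith [Real.exp_one_lt_three, hf.1 x]
  have h1 := hf.integral_Ioi_le hlt he hfi
  have h2 := hf.integral_Ioc_le hfi hz hl hzx (by linarith)
  have h3 : ∫ t in Set.Ioi z, f t = (∫ t in Set.Ioc z x, f t) + ∫ t in Set.Ioi x, f t := by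
    rw [← setIntegral_union (Set.Ioc_disjoint_Ioi le_rfl) measurableSet_Ioi hfi.integrableOn
      hfi.integrableOn, Set.Ioc_union_Ioi_eq_Ioi hzx]
  have h4 : f x * (x - z) < f z * (x - z) :=
    mul_lt_mul_of_pos_right (by linarith [hf.1 x]) (by linarith)
  linarith

lemma integral_Iic_eq_one_sub {h : ℝ → ℝ} (hi : Integrable h) (h1 : ∫ x, h x = 1) (x : ℝ) :
    ∫ t in Set.Iic x, h t = 1 - ∫ t in Set.Ioi x, h t := by
  rw [← h1, ← integral_add_compl (measurableSet_Iic (a := x)) hi, Set.compl_Iic]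
  ring

lemma transport_lower_bound_of_integral_Ioi_le {f g T : ℝ → ℝ} {ν z : ℝ}
    (hf : LogConcaveFn f) (hg : LogConcaveFn g) (hfi : Integrable f) (hgi : Integrable g)
    (hf1 : ∫ x, f x = 1) (hg1 : ∫ x, g x = 1) (hν : 0 < ν) (hz : 0 < f z)
    (hl : ν ≤ ∫ t in Set.Iic z, f t) (hr : ν ≤ ∫ t in Set.Ioi z, f t)
    (hgz : ∫ t in Set.Ioi z, g t ≤ ν / 2)
    (hT : ∀ x ∈ {x : ℝ | 0 < f x}, ∫ t in Set.Iic x, f t = ∫ t in Set.Iic (T x), g t)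
    (hTc : ContinuousOn T {x : ℝ | 0 < f x}) :
    1 / 12288 * ν ^ 3 / f z ^ 2 ≤
      ∫ x in Set.Icc (z - ν / f z) (z + ν / f z), (T x - x) ^ 2 * f x := by
  have hint := integrable_transport_cost hf hg hfi hgi hf1 hg1 hT hTc
  set d := ν / f z with hd
  have hd0 : 0 < d := by positivity
  have hfd : f z * d = ν := by rw [hd]; field_simp
  have hpt : ∀ x ∈ Set.Icc (z + d / 16) (z + d / 8),
      (d / 16) ^ 2 * (f z / 3) ≤ (T x - x) ^ 2 * f x := by
    intro x hx
    have hzx : z ≤ x := by linarith [hx.1]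
    have hxd : 8 * (f z * (x - z)) ≤ ν := by rw [← hfd]; nlinarith [hx.2]
    have hlow := hf.le_three_mul_of_integral_Ioi hfi hz hl hr hzx (by linarith)
    have hmass := hf.integral_Ioc_le hfi hz hl hzx (by linarith)
    have hTz : T x < z := by
      by_contra! hcon
      have h1 : ∫ t in Set.Iic z, g t ≤ ∫ t in Set.Iic (T x), g t :=
        setIntegral_mono_set hgi.integrableOn (Filter.Eventually.of_forall hg.1)
          (Set.Iic_subset_Iic.2 hcon).eventuallyLE
      have h2 : ∫ t in Set.Iic x, f t = (∫ t in Set.Iic z, f t) + ∫ t in Set.Ioc z x, f t := by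
        rw [← setIntegral_union (Set.Iic_disjoint_Ioc le_rfl) measurableSet_Ioc hfi.integrableOn
          hfi.integrableOn, Set.Iic_union_Ioc_eq_Iic hzx]
      have h3 := hT x (show 0 < f x by linarith)
      have h4 := integral_Iic_eq_one_sub hgi hg1 z
      have h5 := integral_Iic_eq_one_sub hfi hf1 z
      linarith
    exact mul_le_mul (by nlinarith [hx.1]) (by linarith) (by positivity) (sq_nonneg _)
  calc 1 / 12288 * ν ^ 3 / f z ^ 2
      = ∫ x in Set.Icc (z + d / 16) (z + d / 8), (d / 16) ^ 2 * (f z / 3) := by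
        rw [setIntegral_const, Measure.real, Real.volume_Icc, ENNReal.toReal_ofReal (by linarith),
          smul_eq_mul, hd]
        field_simp
        ring
    _ ≤ ∫ x in Set.Icc (z + d / 16) (z + d / 8), (T x - x) ^ 2 * f x :=
        setIntegral_mono_on (integrableOn_const (by simp)) hint.integrableOn measurableSet_Icc hpt
    _ ≤ ∫ x in Set.Icc (z - d) (z + d), (T x - x) ^ 2 * f x :=
        setIntegral_mono_set hint.integrableOn
          (Filter.Eventually.of_forall fun x => mul_nonneg (sq_nonneg _) (hf.1 x))
          (Set.Icc_subset_Icc (by linarith) (by linarith)).eventuallyLE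

theorem local_transport_lower_bound :
    ∃ c : ℝ, 0 < c ∧
      ∀ (f g T : ℝ → ℝ) (ν z : ℝ),
        LogConcaveFn f → LogConcaveFn g →
        Integrable f → Integrable g →
        (∫ x, f x) = 1 → (∫ x, g x) = 1 →
        0 < ν → 0 < f z →
        ν ≤ ∫ t in Set.Iic z, f t → ν ≤ ∫ t in Set.Ioi z, f t →
        ((∫ t in Set.Ioi z, g t) ≤ ν / 2 ∨ (∫ t in Set.Iic z, g t) ≤ ν / 2) →
        (∀ x ∈ {x : ℝ | 0 < f x},
          ∫ t in Set.Iic x, f t = ∫ t in Set.Iic (T x), g t) →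
        MonotoneOn T {x : ℝ | 0 < f x} →
        ContinuousOn T {x : ℝ | 0 < f x} →
        c * ν ^ 3 / f z ^ 2 ≤
          ∫ x in Set.Icc (z - ν / f z) (z + ν / f z), (T x - x) ^ 2 * f x := by
  refine ⟨1 / 12288, by norm_num, ?_⟩
  rintro f g T ν z hf hg hfi hgi hf1 hg1 hν hz hl hr (hgz | hgz) hT - hTc
  · exact transport_lower_bound_of_integral_Ioi_le hf hg hfi hgi hf1 hg1 hν hz hl hr hgz hT hTc
  have key := transport_lower_bound_of_integral_Ioi_le (T := fun x => -T (-x)) (z := -z)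
    hf.comp_neg hg.comp_neg hfi.comp_neg hgi.comp_neg
    (by rw [integral_neg_eq_self f volume, hf1]) (by rw [integral_neg_eq_self g volume, hg1]) hν
    (by simpa using hz) (by simpa [integral_comp_neg_Iic] using hr)
    (by simpa [integral_comp_neg_Ioi] using hl) (by simpa [integral_comp_neg_Ioi] using hgz)
    (fun x hx => by
      have h1 := hT (-x) hx
      rw [integral_Iic_eq_one_sub hfi hf1, integral_Iic_eq_one_sub hgi hg1] at h1
      rw [integral_comp_neg_Iic, integral_comp_neg_Iic, neg_neg]
      linarith)
    (hTc.comp continuous_neg.continuousOn fun x hx => hx).neg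
  simp only [neg_neg] at key
  refine key.trans_eq ?_
  rw [← integral_indicator measurableSet_Icc, ← integral_indicator measurableSet_Icc,
    ← integral_neg_eq_self]
  congr 1
  funext x
  have hmem : -x ∈ Set.Icc (-z - ν / f z) (-z + ν / f z) ↔
      x ∈ Set.Icc (z - ν / f z) (z + ν / f z) := by
    constructor <;> rintro ⟨h1, h2⟩ <;> constructor <;> linarith
  by_cases hx : x ∈ Set.Icc (z - ν / f z) (z + ν / f z)
  · rw [Set.indicator_of_mem hx, Set.indicator_of_mem (hmem.2 hx), neg_neg]
    ring
  · rw [Set.indicator_of_notMem hx, Set.indicator_of_notMem (mt hmem.1 hx)]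
end
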